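/- arXiv:2604.05661 — 10 statements merged into one kernel-verified Lean document; each statement's English description precedes it below -/
import Mathlib

section
/- Let m, n be positive integers, let 𝒜 ⊆ 2^{[m]} and ℬ ⊆ 2^{[n]} be nonempty set systems, and define their product 𝒜 ⊗ ℬ := { A ∪ { m + b : b ∈ B } : A ∈ 𝒜, B ∈ ℬ } ⊆ 2^{[m+n]}. Then |𝒜 ⊗ ℬ| = |𝒜| · |ℬ| and c(𝒜 ⊗ ℬ) = c(𝒜) · c(ℬ) · binomial(m+n, m); consequently η(𝒜 ⊗ ℬ)^{m+n} = η(𝒜)^m · η(ℬ)^n, so in particular if η(𝒜) = η(ℬ) then η(𝒜 ⊗ ℬ) = η(𝒜). -/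
/-- The number of maximal chains `∅ = A₀ ⊊ A₁ ⊊ ⋯ ⊊ Aₙ = [n]` of a set system
`𝒜 ⊆ 2^{[n]}` (all `Aᵢ ∈ 𝒜`). -/
noncomputable def chainCount (n : ℕ) (𝒜 : Finset (Finset (Fin n))) : ℕ :=
  Nat.card {f : Fin (n + 1) → Finset (Fin n) //
    (∀ i, f i ∈ 𝒜) ∧ ∀ i : Fin n, f i.castSucc ⊂ f i.succ}

/-- The chain efficiency `η(𝒜) = (c(𝒜)/(|𝒜|² · n!))^{1/n}`. -/
noncomputable def eta (n : ℕ) (𝒜 : Finset (Finset (Fin n))) : ℝ :=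
  ((chainCount n 𝒜 : ℝ) / ((𝒜.card : ℝ) ^ 2 * (n.factorial : ℝ))) ^ ((1 : ℝ) / n)

/-- The product set system `𝒜 ⊗ ℬ := { A ∪ { m + b : b ∈ B } : A ∈ 𝒜, B ∈ ℬ }`. -/
def prodSys (m n : ℕ) (𝒜 : Finset (Finset (Fin m))) (ℬ : Finset (Finset (Fin n))) :
    Finset (Finset (Fin (m + n))) :=
  (𝒜 ×ˢ ℬ).image fun p => p.1.image (Fin.castAdd n) ∪ p.2.image (Fin.natAdd m)

/-- The chains `A₀ ⊊ A₁ ⊊ ⋯ ⊊ Aₖ = S` of members of `𝒜`; if `S` has `k` elements, these are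
the saturated chains from `∅` to `S`. -/
noncomputable def chainsTo {α : Type*} [Fintype α] [DecidableEq α] (𝒜 : Finset (Finset α))
    (k : ℕ) (S : Finset α) : Finset (Fin (k + 1) → Finset α) :=
  {f | ((∀ i, f i ∈ 𝒜) ∧ ∀ i : Fin k, f i.castSucc ⊂ f i.succ) ∧ f (Fin.last k) = S}

theorem le_card_of_strict_chain {α : Type*} {k : ℕ} {f : Fin (k + 1) → Finset α}
    (hf : ∀ i : Fin k, f i.castSucc ⊂ f i.succ) (i : Fin (k + 1)) : (i : ℕ) ≤ (f i).card := by
  induction i using Fin.induction with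
  | zero => simp
  | succ i ih =>
    have := Finset.card_lt_card (hf i)
    simp only [Fin.val_castSucc, Fin.val_succ] at *
    omega

section Chains

variable {α : Type*} [Fintype α] [DecidableEq α] {𝒜 : Finset (Finset α)}

theorem mem_chainsTo {k : ℕ} {S : Finset α} {f : Fin (k + 1) → Finset α} :
    f ∈ chainsTo 𝒜 k S ↔
      ((∀ i, f i ∈ 𝒜) ∧ ∀ i : Fin k, f i.castSucc ⊂ f i.succ) ∧ f (Fin.last k) = S := by
  simp [chainsTo]

theorem card_chainsTo_zero (S : Finset α) :
    (chainsTo 𝒜 0 S).card = if S ∈ 𝒜 then 1 else 0 := by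
  split_ifs with h
  · rw [Finset.card_eq_one]
    refine ⟨fun _ => S, ?_⟩
    ext f
    rw [mem_chainsTo, Finset.mem_singleton]
    constructor
    · rintro ⟨-, hf⟩
      funext i
      rw [← hf]
      exact congrArg f (Fin.fin_one_eq_zero i)
    · rintro rfl
      exact ⟨⟨fun _ => h, fun i => i.elim0⟩, rfl⟩
  · rw [Finset.card_eq_zero, Finset.eq_empty_iff_forall_notMem]
    intro f hf
    rw [mem_chainsTo] at hf
    exact h (hf.2 ▸ hf.1.1 _)

theorem chainsTo_succ {k : ℕ} {S : Finset α} (hS : S.card = k + 1) (h : S ∈ 𝒜) :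
    chainsTo 𝒜 (k + 1) S = S.biUnion fun x =>
      (chainsTo 𝒜 k (S.erase x)).image fun f => (Fin.snoc f S : Fin (k + 2) → Finset α) := by
  ext f
  simp only [Finset.mem_biUnion, Finset.mem_image, mem_chainsTo]
  constructor
  · rintro ⟨⟨hmem, hlt⟩, hlast⟩
    have hss : f (Fin.last k).castSucc ⊂ S := by
      have := hlt (Fin.last k)
      rwa [Fin.succ_last, hlast] at this
    obtain ⟨x, hx, hsub⟩ := Finset.ssubset_iff_exists_subset_erase.1 hss
    refine ⟨x, hx, Fin.init f, ⟨⟨fun i => hmem _, fun i => ?_⟩, ?_⟩, ?_⟩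
    · have := hlt i.castSucc
      rwa [Fin.succ_castSucc] at this
    · refine Finset.eq_of_subset_of_card_le hsub ?_
      rw [Finset.card_erase_of_mem hx, hS]
      exact le_card_of_strict_chain hlt (Fin.last k).castSucc
    · rw [← hlast]
      exact Fin.snoc_init_self f
  · rintro ⟨x, hx, g, ⟨⟨hmem, hlt⟩, hlast⟩, rfl⟩
    refine ⟨⟨fun i => ?_, fun i => ?_⟩, by simp⟩
    · induction i using Fin.lastCases with
      | last => simpa using h
      | cast i => simpa using hmem i
    · induction i using Fin.lastCases with
      | last =>
        rw [Fin.succ_last, Fin.snoc_castSucc, Fin.snoc_last, hlast]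
        exact Finset.erase_ssubset hx
      | cast i =>
        rw [Fin.succ_castSucc, Fin.snoc_castSucc, Fin.snoc_castSucc]
        exact hlt i

theorem card_chainsTo_succ {k : ℕ} {S : Finset α} (hS : S.card = k + 1) :
    (chainsTo 𝒜 (k + 1) S).card =
      if S ∈ 𝒜 then ∑ x ∈ S, (chainsTo 𝒜 k (S.erase x)).card else 0 := by
  split_ifs with h
  · rw [chainsTo_succ hS h, Finset.card_biUnion]
    · refine Finset.sum_congr rfl fun x _ => Finset.card_image_of_injective _ fun f g hfg => ?_
      exact (Fin.snoc_injective2 hfg).1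
    · intro x hx y hy hxy
      refine Finset.disjoint_left.2 fun f hf hg => ?_
      simp only [Finset.mem_image, mem_chainsTo] at hf hg
      obtain ⟨f₁, ⟨-, h₁⟩, rfl⟩ := hf
      obtain ⟨f₂, ⟨-, h₂⟩, h₃⟩ := hg
      obtain rfl := (Fin.snoc_injective2 h₃).1
      exact hxy (Finset.erase_injOn S hx hy (h₁.symm.trans h₂))
  · rw [Finset.card_eq_zero, Finset.eq_empty_iff_forall_notMem]
    intro f hf
    rw [mem_chainsTo] at hf
    exact h (hf.2 ▸ hf.1.1 _)

end Chains

theorem chainCount_eq_card_chainsTo (n : ℕ) (𝒜 : Finset (Finset (Fin n))) :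
    chainCount n 𝒜 = (chainsTo 𝒜 n Finset.univ).card := by
  rw [chainCount, Nat.card_eq_fintype_card, Fintype.card_subtype]
  congr 1
  ext f
  simp only [Finset.mem_filter_univ, mem_chainsTo]
  refine ⟨fun hf => ⟨hf, ?_⟩, fun hf => hf.1⟩
  rw [← Finset.card_eq_iff_eq_univ, Fintype.card_fin]
  refine le_antisymm ?_ (by simpa using le_card_of_strict_chain hf.2 (Fin.last n))
  simpa using Finset.card_le_univ (f (Fin.last n))

section Product

variable {m n : ℕ}

/-- The set `A ∪ (m + B)`. -/
def shiftedUnion (A : Finset (Fin m)) (B : Finset (Fin n)) : Finset (Fin (m + n)) :=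
  A.image (Fin.castAdd n) ∪ B.image (Fin.natAdd m)

theorem castAdd_ne_natAdd (x : Fin m) (y : Fin n) : Fin.castAdd n x ≠ Fin.natAdd m y := by
  intro h
  have := congrArg Fin.val h
  simp only [Fin.val_castAdd, Fin.val_natAdd] at this
  omega

theorem castAdd_mem_shiftedUnion {A : Finset (Fin m)} {B : Finset (Fin n)} {x : Fin m} :
    Fin.castAdd n x ∈ shiftedUnion A B ↔ x ∈ A := by
  simp [shiftedUnion, (castAdd_ne_natAdd _ _).symm]

theorem natAdd_mem_shiftedUnion {A : Finset (Fin m)} {B : Finset (Fin n)} {y : Fin n} :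
    Fin.natAdd m y ∈ shiftedUnion A B ↔ y ∈ B := by
  simp [shiftedUnion, castAdd_ne_natAdd]

theorem shiftedUnion_injective2 :
    Function.Injective2 (shiftedUnion : Finset (Fin m) → Finset (Fin n) → _) := by
  intro A A' B B' h
  constructor
  · ext x
    rw [← castAdd_mem_shiftedUnion (B := B), h, castAdd_mem_shiftedUnion]
  · ext y
    rw [← natAdd_mem_shiftedUnion (A := A), h, natAdd_mem_shiftedUnion]

theorem shiftedUnion_mem_prodSys {𝒜 : Finset (Finset (Fin m))} {ℬ : Finset (Finset (Fin n))}
    {A : Finset (Fin m)} {B : Finset (Fin n)} :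
    shiftedUnion A B ∈ prodSys m n 𝒜 ℬ ↔ A ∈ 𝒜 ∧ B ∈ ℬ := by
  simp only [prodSys, Finset.mem_image, Finset.mem_product, Prod.exists]
  constructor
  · rintro ⟨A', B', h, he⟩
    have he : shiftedUnion A' B' = shiftedUnion A B := he
    obtain ⟨rfl, rfl⟩ := shiftedUnion_injective2 he
    exact h
  · exact fun h => ⟨A, B, h, rfl⟩

theorem card_prodSys (𝒜 : Finset (Finset (Fin m))) (ℬ : Finset (Finset (Fin n))) :
    (prodSys m n 𝒜 ℬ).card = 𝒜.card * ℬ.card := by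
  rw [← Finset.card_product]
  exact Finset.card_image_of_injective _ shiftedUnion_injective2.uncurry

theorem disjoint_image_castAdd_natAdd (A : Finset (Fin m)) (B : Finset (Fin n)) :
    Disjoint (A.image (Fin.castAdd n)) (B.image (Fin.natAdd m)) := by
  rw [Finset.disjoint_left]
  intro z hz hz'
  simp only [Finset.mem_image] at hz hz'
  obtain ⟨x, -, rfl⟩ := hz
  obtain ⟨y, -, h⟩ := hz'
  exact castAdd_ne_natAdd _ _ h.symm

theorem sum_shiftedUnion (A : Finset (Fin m)) (B : Finset (Fin n)) (w : Fin (m + n) → ℕ) :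
    ∑ z ∈ shiftedUnion A B, w z =
      ∑ x ∈ A, w (Fin.castAdd n x) + ∑ y ∈ B, w (Fin.natAdd m y) := by
  rw [shiftedUnion, Finset.sum_union (disjoint_image_castAdd_natAdd A B),
    Finset.sum_image (Fin.castAdd_injective m n).injOn,
    Finset.sum_image (Fin.natAdd_injective n m).injOn]

theorem card_shiftedUnion (A : Finset (Fin m)) (B : Finset (Fin n)) :
    (shiftedUnion A B).card = A.card + B.card := by
  simp only [Finset.card_eq_sum_ones, sum_shiftedUnion]

theorem shiftedUnion_erase_castAdd (A : Finset (Fin m)) (B : Finset (Fin n)) (x : Fin m) :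
    (shiftedUnion A B).erase (Fin.castAdd n x) = shiftedUnion (A.erase x) B := by
  ext z
  induction z using Fin.addCases with
  | left i => simp [castAdd_mem_shiftedUnion]
  | right j => simp [natAdd_mem_shiftedUnion, (castAdd_ne_natAdd _ _).symm]

theorem shiftedUnion_erase_natAdd (A : Finset (Fin m)) (B : Finset (Fin n)) (y : Fin n) :
    (shiftedUnion A B).erase (Fin.natAdd m y) = shiftedUnion A (B.erase y) := by
  ext z
  induction z using Fin.addCases with
  | left i => simp [castAdd_mem_shiftedUnion, castAdd_ne_natAdd]
  | right j => simp [natAdd_mem_shiftedUnion]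

theorem shiftedUnion_univ :
    shiftedUnion (Finset.univ : Finset (Fin m)) (Finset.univ : Finset (Fin n)) = Finset.univ := by
  ext z
  induction z using Fin.addCases with
  | left i => simp [castAdd_mem_shiftedUnion]
  | right j => simp [natAdd_mem_shiftedUnion]

theorem card_chainsTo_shiftedUnion (𝒜 : Finset (Finset (Fin m))) (ℬ : Finset (Finset (Fin n)))
    {a b : ℕ} {A : Finset (Fin m)} {B : Finset (Fin n)} (hA : A.card = a) (hB : B.card = b) :
    (chainsTo (prodSys m n 𝒜 ℬ) (a + b) (shiftedUnion A B)).card =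
      (chainsTo 𝒜 a A).card * (chainsTo ℬ b B).card * (a + b).choose a := by
  induction hk : a + b generalizing a b A B with
  | zero =>
    obtain ⟨rfl, rfl⟩ : a = 0 ∧ b = 0 := by omega
    simp only [card_chainsTo_zero, shiftedUnion_mem_prodSys]
    by_cases h₁ : A ∈ 𝒜 <;> by_cases h₂ : B ∈ ℬ <;> simp [h₁, h₂]
  | succ k ih =>
    rw [card_chainsTo_succ (by rw [card_shiftedUnion]; omega)]
    simp only [shiftedUnion_mem_prodSys]
    split_ifs with h
    · obtain ⟨h₁, h₂⟩ := h
      simp only [sum_shiftedUnion, shiftedUnion_erase_castAdd, shiftedUnion_erase_natAdd]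
      have left : ∑ x ∈ A, (chainsTo (prodSys m n 𝒜 ℬ) k (shiftedUnion (A.erase x) B)).card =
          (chainsTo 𝒜 a A).card * (chainsTo ℬ b B).card *
            if a = 0 then 0 else k.choose (a - 1) := by
        cases a with
        | zero => simp [Finset.card_eq_zero.1 hA]
        | succ a =>
          rw [card_chainsTo_succ hA, if_pos h₁, if_neg a.succ_ne_zero, Finset.sum_mul,
            Finset.sum_mul]
          refine Finset.sum_congr rfl fun x hx => ?_
          exact ih (by rw [Finset.card_erase_of_mem hx, hA]; rfl) hB (by omega)
      have right : ∑ y ∈ B, (chainsTo (prodSys m n 𝒜 ℬ) k (shiftedUnion A (B.erase y))).card =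
          (chainsTo 𝒜 a A).card * (chainsTo ℬ b B).card * k.choose a := by
        cases b with
        | zero => simp [Finset.card_eq_zero.1 hB, Nat.choose_eq_zero_of_lt (show k < a by omega)]
        | succ b =>
          rw [card_chainsTo_succ hB, if_pos h₂, Finset.mul_sum, Finset.sum_mul]
          refine Finset.sum_congr rfl fun y hy => ?_
          exact ih hA (by rw [Finset.card_erase_of_mem hy, hB]; rfl) (by omega)
      rw [left, right, ← mul_add]
      congr 1
      cases a with
      | zero => simp
      | succ a => simp [Nat.choose_succ_succ]
    · have hzero : (chainsTo 𝒜 a A).card = 0 ∨ (chainsTo ℬ b B).card = 0 := by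
        simp only [Finset.card_eq_zero, Finset.eq_empty_iff_forall_notMem, mem_chainsTo]
        by_contra! hc
        obtain ⟨⟨f, hf, hfA⟩, g, hg, hgB⟩ := hc
        exact h ⟨hfA ▸ hf.1 _, hgB ▸ hg.1 _⟩
      rcases hzero with h₀ | h₀ <;> simp [h₀]

theorem chainCount_prodSys (𝒜 : Finset (Finset (Fin m))) (ℬ : Finset (Finset (Fin n))) :
    chainCount (m + n) (prodSys m n 𝒜 ℬ)
      = chainCount m 𝒜 * chainCount n ℬ * (m + n).choose m := by
  simp only [chainCount_eq_card_chainsTo, ← shiftedUnion_univ (m := m) (n := n)]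
  exact card_chainsTo_shiftedUnion 𝒜 ℬ (Finset.card_fin m) (Finset.card_fin n)

end Product

theorem eta_nonneg (n : ℕ) (𝒜 : Finset (Finset (Fin n))) : 0 ≤ eta n 𝒜 := by
  unfold eta
  positivity

theorem eta_pow {n : ℕ} (hn : n ≠ 0) (𝒜 : Finset (Finset (Fin n))) :
    eta n 𝒜 ^ n = (chainCount n 𝒜 : ℝ) / ((𝒜.card : ℝ) ^ 2 * (n.factorial : ℝ)) := by
  rw [eta, one_div, Real.rpow_inv_natCast_pow (by positivity) hn]

theorem eta_prodSys_pow {m n : ℕ} (hm : m ≠ 0) (hn : n ≠ 0)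
    (𝒜 : Finset (Finset (Fin m))) (ℬ : Finset (Finset (Fin n))) :
    eta (m + n) (prodSys m n 𝒜 ℬ) ^ (m + n) = eta m 𝒜 ^ m * eta n ℬ ^ n := by
  rw [eta_pow (by omega), eta_pow hm, eta_pow hn, card_prodSys, chainCount_prodSys,
    ← Nat.add_choose_mul_factorial_mul_factorial m n, div_mul_div_comm]
  push_cast
  have hc : ((m + n).choose m : ℝ) ≠ 0 := by
    exact_mod_cast (Nat.choose_pos (Nat.le_add_right m n)).ne'
  rw [← mul_div_mul_right (_ * _) (_ * _ * (_ * _)) hc, ← Nat.choose_symm_add]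
  congr 1
  ring

theorem stmt0 (m n : ℕ) (hm : 0 < m) (hn : 0 < n)
    (𝒜 : Finset (Finset (Fin m))) (ℬ : Finset (Finset (Fin n)))
    (h𝒜 : 𝒜.Nonempty) (hℬ : ℬ.Nonempty) :
    (prodSys m n 𝒜 ℬ).card = 𝒜.card * ℬ.card ∧
    chainCount (m + n) (prodSys m n 𝒜 ℬ)
      = chainCount m 𝒜 * chainCount n ℬ * (m + n).choose m ∧
    eta (m + n) (prodSys m n 𝒜 ℬ) ^ (m + n) = eta m 𝒜 ^ m * eta n ℬ ^ n ∧
    (eta m 𝒜 = eta n ℬ → eta (m + n) (prodSys m n 𝒜 ℬ) = eta m 𝒜) := by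
  have hpow := eta_prodSys_pow hm.ne' hn.ne' 𝒜 ℬ
  refine ⟨card_prodSys 𝒜 ℬ, chainCount_prodSys 𝒜 ℬ, hpow, fun h => ?_⟩
  rw [← h, ← pow_add] at hpow
  exact (pow_left_inj₀ (eta_nonneg _ _) (eta_nonneg _ _) (by omega)).1 hpow
end

section
/- Let n ≥ 2 and let 𝒜 ⊆ 2^{[n]} be a set system with c(𝒜) ≥ 1. Say that a permutation τ of [n] traces a maximal chain of 𝒜 if {τ(1),…,τ(j)} ∈ 𝒜 for every j = 0, 1, …, n. Then there exists a family ℱ of permutations of [n] with |ℱ| ≤ (n!/c(𝒜)) · n · ln n + 1 such that for every permutation π of [n] there exists π′ ∈ ℱ for which the composition π′ ∘ π traces a maximal chain of 𝒜. -/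
/-- A permutation `τ` of `[n]` traces a maximal chain of `𝒜` if
`{τ(1),…,τ(j)} ∈ 𝒜` for every `j = 0, 1, …, n`. -/
def Traces (n : ℕ) (𝒜 : Finset (Finset (Fin n))) (τ : Equiv.Perm (Fin n)) : Prop :=
  ∀ j ≤ n, (Finset.univ.filter fun i : Fin n => (i : ℕ) < j).image τ ∈ 𝒜

/-- Every maximal chain `f` is of the form `j ↦ {τ(1),…,τ(j)}` for some permutation `τ`. -/
theorem exists_perm_of_strict_chain {n : ℕ} (f : Fin (n + 1) → Finset (Fin n))
    (hf : ∀ i : Fin n, f i.castSucc ⊂ f i.succ) :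
    ∃ τ : Equiv.Perm (Fin n), ∀ j : Fin (n + 1),
      f j = (Finset.univ.filter fun i : Fin n => (i : ℕ) < j).image τ := by
  have hmono : Monotone f := (Fin.strictMono_iff_lt_succ.2 hf).monotone
  choose a ha ha' using fun i => Finset.exists_of_ssubset (hf i)
  have hlt : ∀ i k : Fin n, i < k → a i ≠ a k := fun i k hik h =>
    ha' k (h ▸ hmono (Fin.succ_le_castSucc_iff.2 hik) (ha i))
  have hinj : Function.Injective a := by
    intro i k h
    rcases lt_trichotomy i k with hik | hik | hik
    · exact absurd h (hlt i k hik)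
    · exact hik
    · exact absurd h.symm (hlt k i hik)
  have hbij : Function.Bijective a := Finite.injective_iff_bijective.1 hinj
  refine ⟨Equiv.ofBijective a hbij, fun j => ?_⟩
  ext x
  obtain ⟨i, rfl⟩ := hbij.2 x
  simp only [Finset.mem_image, Finset.mem_filter, Finset.mem_univ, true_and,
    Equiv.ofBijective_apply]
  constructor
  · intro hx
    refine ⟨i, ?_, rfl⟩
    by_contra! hij
    exact ha' i (hmono (show j ≤ i.castSucc from hij) hx)
  · rintro ⟨k, hk, hki⟩
    rw [← hki]
    exact hmono (show k.succ ≤ j from hk) (ha k)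

/-- There are at least as many permutations tracing a maximal chain as maximal chains. -/
theorem chainCount_le_card_traces (n : ℕ) (𝒜 : Finset (Finset (Fin n)))
    [DecidablePred (Traces n 𝒜)] :
    chainCount n 𝒜 ≤ (Finset.univ.filter (Traces n 𝒜)).card := by
  choose τ hτ using fun f : {f : Fin (n + 1) → Finset (Fin n) //
    (∀ i, f i ∈ 𝒜) ∧ ∀ i : Fin n, f i.castSucc ⊂ f i.succ} =>
      exists_perm_of_strict_chain f.1 f.2.2
  have htr : ∀ f, Traces n 𝒜 (τ f) := fun f j hj => by
    have h := f.2.1 ⟨j, Nat.lt_succ_of_le hj⟩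
    rwa [hτ f] at h
  rw [← Fintype.card_subtype, ← Nat.card_eq_fintype_card]
  refine Nat.card_le_card_of_injective (fun f => ⟨τ f, htr f⟩) fun f g h => ?_
  have h' : τ f = τ g := congrArg Subtype.val h
  refine Subtype.ext (funext fun j => ?_)
  rw [hτ f, hτ g, h']

/-- Averaging: some left translation sends at least a `|T| / |G|` fraction of `U` into `T`. -/
theorem exists_mul_card_le_card_filter_mul_mem {G : Type*} [Group G] [Fintype G] [DecidableEq G]
    (T U : Finset G) :
    ∃ g : G, U.card * T.card ≤ Fintype.card G * (U.filter fun x => g * x ∈ T).card := by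
  have hsum : ∑ g : G, (U.filter fun x => g * x ∈ T).card = U.card * T.card := by
    simp only [Finset.card_filter]
    rw [Finset.sum_comm, Finset.card_eq_sum_ones U, Finset.sum_mul]
    refine Finset.sum_congr rfl fun x _ => ?_
    rw [one_mul]
    exact (Fintype.sum_equiv (Equiv.mulRight x) _ (fun y => if y ∈ T then 1 else 0)
      fun _ => rfl).trans (by simp)
  by_contra! h
  have := Finset.sum_lt_sum_of_nonempty Finset.univ_nonempty fun g _ => h g
  rw [← Finset.mul_sum, hsum, Finset.sum_const, Finset.card_univ, smul_eq_mul] at this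
  exact this.false

/-- Greedy covering: `k` left translations leave at most a `(1 - |T| / |G|) ^ k` fraction
of the group outside `T`. -/
theorem exists_card_le_card_uncovered_le {G : Type*} [Group G] [Fintype G] [DecidableEq G]
    (T : Finset G) (k : ℕ) :
    ∃ F : Finset G, F.card ≤ k ∧
      ((Finset.univ.filter fun x => ∀ g ∈ F, g * x ∉ T).card : ℝ) ≤
        Fintype.card G * (1 - (T.card : ℝ) / Fintype.card G) ^ k := by
  have hN : (0 : ℝ) < Fintype.card G := by exact_mod_cast Fintype.card_pos
  have hT : (T.card : ℝ) / Fintype.card G ≤ 1 := by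
    rw [div_le_one hN]
    exact_mod_cast T.card_le_univ
  induction k with
  | zero => exact ⟨∅, by simp⟩
  | succ k ih =>
    obtain ⟨F, hF, hU⟩ := ih
    set U := Finset.univ.filter fun x => ∀ g ∈ F, g * x ∉ T
    obtain ⟨g, hg⟩ := exists_mul_card_le_card_filter_mul_mem T U
    refine ⟨insert g F, (Finset.card_insert_le _ _).trans (by lia), ?_⟩
    have hU' : (Finset.univ.filter fun x => ∀ h ∈ insert g F, h * x ∉ T) =
        U.filter fun x => ¬ g * x ∈ T := by
      ext x
      simp [U, and_comm]
    have hcard : ((U.filter fun x => g * x ∈ T).card : ℝ) +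
        (U.filter fun x => ¬ g * x ∈ T).card = U.card := by
      exact_mod_cast Finset.card_filter_add_card_filter_not (s := U) (fun x => g * x ∈ T)
    have hg' : (U.card : ℝ) * (T.card / Fintype.card G) ≤
        (U.filter fun x => g * x ∈ T).card := by
      rw [← mul_div_assoc, div_le_iff₀' hN]
      exact_mod_cast hg
    rw [hU', pow_succ, ← mul_assoc]
    have := mul_le_mul_of_nonneg_right hU (sub_nonneg.2 hT)
    linarith

/-- A nonempty subset `T` of a finite group `G` is hit from every element by one of at most
`(|G| / |T|) log |G| + 1` left translations. -/
theorem exists_card_le_log_forall_exists_mul_mem {G : Type*} [Group G] [Fintype G]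
    [DecidableEq G] (T : Finset G) (hT : T.Nonempty) :
    ∃ F : Finset G,
      (F.card : ℝ) ≤ Fintype.card G / T.card * Real.log (Fintype.card G) + 1 ∧
      ∀ x : G, ∃ g ∈ F, g * x ∈ T := by
  have hN : (0 : ℝ) < Fintype.card G := by exact_mod_cast Fintype.card_pos
  have hN1 : (1 : ℝ) ≤ Fintype.card G := by exact_mod_cast Fintype.card_pos (α := G)
  have hTpos : (0 : ℝ) < T.card := by exact_mod_cast hT.card_pos
  have hTN : (T.card : ℝ) / Fintype.card G ≤ 1 := by
    rw [div_le_one hN]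
    exact_mod_cast T.card_le_univ
  set L : ℝ := Fintype.card G / T.card * Real.log (Fintype.card G) with hL
  have hL0 : 0 ≤ L := mul_nonneg (div_pos hN hTpos).le (Real.log_nonneg hN1)
  obtain ⟨F, hF, hU⟩ := exists_card_le_card_uncovered_le T (⌊L⌋₊ + 1)
  refine ⟨F, ?_, ?_⟩
  · have h1 : (F.card : ℝ) ≤ (⌊L⌋₊ : ℝ) + 1 := by exact_mod_cast hF
    linarith [Nat.floor_le hL0]
  · have hlog : Real.log (Fintype.card G) <
        (T.card : ℝ) / Fintype.card G * ((⌊L⌋₊ + 1 : ℕ) : ℝ) := by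
      have h := mul_lt_mul_of_pos_left (Nat.lt_floor_add_one L) (div_pos hTpos hN)
      have h' : (T.card : ℝ) / Fintype.card G * L = Real.log (Fintype.card G) := by
        rw [hL]
        field_simp
      rw [h'] at h
      exact_mod_cast h
    have hpow : (1 - (T.card : ℝ) / Fintype.card G) ^ (⌊L⌋₊ + 1) ≤
        Real.exp (-((T.card : ℝ) / Fintype.card G * ((⌊L⌋₊ + 1 : ℕ) : ℝ))) := by
      refine (pow_le_pow_left₀ (sub_nonneg.2 hTN) (Real.one_sub_le_exp_neg _) _).trans_eq ?_
      rw [← Real.exp_nat_mul]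
      congr 1
      ring
    have hlt : (Fintype.card G : ℝ) * (1 - (T.card : ℝ) / Fintype.card G) ^ (⌊L⌋₊ + 1) < 1 := by
      calc _ ≤ (Fintype.card G : ℝ) *
            Real.exp (-((T.card : ℝ) / Fintype.card G * ((⌊L⌋₊ + 1 : ℕ) : ℝ))) := by gcongr
        _ < Fintype.card G * Real.exp (-Real.log (Fintype.card G)) := by gcongr
        _ = 1 := by rw [Real.exp_neg, Real.exp_log hN, mul_inv_cancel₀ hN.ne']
    have hempty := hU.trans_lt hlt
    rw [Nat.cast_lt_one, Finset.card_eq_zero, Finset.filter_eq_empty_iff] at hempty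
    intro x
    simpa using hempty (Finset.mem_univ x)

theorem stmt1 (n : ℕ) (hn : 2 ≤ n) (𝒜 : Finset (Finset (Fin n)))
    (hc : 1 ≤ chainCount n 𝒜) :
    ∃ F : Finset (Equiv.Perm (Fin n)),
      (F.card : ℝ) ≤ (n.factorial : ℝ) / (chainCount n 𝒜 : ℝ) * n * Real.log n + 1 ∧
      ∀ π : Equiv.Perm (Fin n), ∃ π' ∈ F, Traces n 𝒜 (π' * π) := by
  classical
  have hle := chainCount_le_card_traces n 𝒜
  obtain ⟨F, hF, hcov⟩ := exists_card_le_log_forall_exists_mul_mem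
    (Finset.univ.filter (Traces n 𝒜)) (Finset.card_pos.1 (hc.trans hle))
  refine ⟨F, hF.trans ?_, by simpa using hcov⟩
  rw [Fintype.card_perm, Fintype.card_fin]
  have hlog : Real.log n.factorial ≤ n * Real.log n := by
    rw [← Real.log_pow]
    exact Real.log_le_log (by exact_mod_cast n.factorial_pos) (by exact_mod_cast n.factorial_le_pow)
  have hlog0 : 0 ≤ Real.log (n.factorial : ℝ) :=
    Real.log_nonneg (by exact_mod_cast n.factorial_pos)
  have hc0 : (0 : ℝ) < chainCount n 𝒜 := by exact_mod_cast hc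
  rw [mul_assoc]
  gcongr
end

section
/- Let t, k ≥ 1, let n = t·k, let X be an n-element set partitioned into blocks X₁,…,X_k each of size t, and let 𝒯_t = { A ⊆ X : X₁ ∪ ⋯ ∪ X_s ⊆ A ⊆ X₁ ∪ ⋯ ∪ X_{s+1} for some 0 ≤ s ≤ k−1 } be the tower of t-cubes. Then |𝒯_t| = k·(2^t − 1) + 1 and c(𝒯_t) = (t!)^k. -/
open Finset in
/-- The number of sets `A` such that no element outside `A` has strictly smaller block index than
an element of `A`, when each block has size `t`. -/
theorem card_tower {X : Type*} [Fintype X] [DecidableEq X] {k t : ℕ} (b : X → Fin k)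
    (hb : ∀ i, #{x | b x = i} = t) :
    #{A : Finset X | ∀ x ∈ A, ∀ y ∉ A, b x ≤ b y} = k * (2 ^ t - 1) + 1 := by
  have key : ({A : Finset X | ∀ x ∈ A, ∀ y ∉ A, b x ≤ b y} : Finset (Finset X)) =
      insert ∅ (univ.biUnion fun s : Fin k =>
        ((univ.filter fun x => b x = s).powerset.erase ∅).image
          fun D => (univ.filter fun x => b x < s) ∪ D) := by
    ext A
    simp only [mem_filter, mem_univ, true_and, mem_insert, mem_biUnion, mem_image, mem_erase,
      mem_powerset]
    constructor
    · intro hA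
      rcases A.eq_empty_or_nonempty with h | h
      · exact Or.inl h
      · right
        obtain ⟨m, hm, hmax⟩ := A.exists_max_image b h
        refine ⟨b m, A.filter fun x => b x = b m, ⟨?_, ?_⟩, ?_⟩
        · exact (Nonempty.ne_empty ⟨m, by simp [hm]⟩)
        · exact fun x hx => by simpa using (mem_filter.1 hx).2
        · ext x
          simp only [mem_union, mem_filter, mem_univ, true_and]
          constructor
          · rintro (hx | hx)
            · by_contra hxA
              exact absurd (hA m hm x hxA) (not_le.2 hx)
            · exact hx.1
          · intro hx
            rcases (hmax x hx).lt_or_eq with h' | h'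
            · exact Or.inl h'
            · exact Or.inr ⟨hx, h'⟩
    · rintro (rfl | ⟨s, D, ⟨-, hD⟩, rfl⟩)
      · simp
      · intro x hx y hy
        have hD' : ∀ z ∈ D, b z = s := fun z hz => by simpa using hD hz
        simp only [mem_union, mem_filter, mem_univ, true_and, not_or, not_lt] at hx hy
        refine le_trans ?_ hy.1
        rcases hx with hx | hx
        · exact hx.le
        · exact (hD' x hx).le
  rw [key, card_insert_of_notMem, card_biUnion]
  · congr 1
    rw [sum_congr rfl (g := fun _ => 2 ^ t - 1)]
    · simp
    · intro s _
      rw [card_image_of_injOn, card_erase_of_mem (empty_mem_powerset _), card_powerset, hb]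
      intro D hD E hE h
      simp only [coe_erase, Set.mem_sdiff, mem_coe, mem_powerset] at hD hE
      have aux : ∀ F ⊆ (univ.filter fun x => b x = s),
          ((univ.filter fun x => b x < s) ∪ F).filter (fun x => b x = s) = F := by
        intro F hF
        ext x
        have := @hF x
        simp only [mem_filter, mem_univ, true_and, mem_union] at this ⊢
        constructor
        · rintro ⟨h | h, h'⟩
          · exact absurd h' h.ne
          · exact h
        · exact fun h => ⟨Or.inr h, this h⟩
      rw [← aux D hD.1, ← aux E hE.1]
      exact congrArg (filter fun x => b x = s) h
  · have aux : ∀ i j : Fin k, i < j → ∀ D ⊆ (univ.filter fun x => b x = i),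
        ∀ E ⊆ (univ.filter fun x => b x = j), E ≠ ∅ →
        (univ.filter fun x => b x < i) ∪ D ≠ (univ.filter fun x => b x < j) ∪ E := by
      intro i j hij D hD E hE hne h
      obtain ⟨x, hx⟩ := nonempty_iff_ne_empty.2 hne
      have hxj : b x = j := by simpa using hE hx
      have hxm := h.symm ▸ mem_union_right (univ.filter fun x => b x < j) hx
      rcases mem_union.1 hxm with h' | h'
      · exact absurd (hxj ▸ (mem_filter.1 h').2) hij.asymm
      · exact hij.ne (((mem_filter.1 (hD h')).2).symm.trans hxj)
    intro i _ j _ hij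
    rw [Function.onFun, disjoint_left]
    intro A hA hA'
    simp only [mem_image, mem_erase, mem_powerset] at hA hA'
    obtain ⟨D, ⟨hD0, hD⟩, rfl⟩ := hA
    obtain ⟨E, ⟨hE0, hE⟩, hEq⟩ := hA'
    rcases lt_or_gt_of_ne hij with h | h
    · exact aux i j h D hD E hE hE0 hEq.symm
    · exact aux j i h E hE D hD hD0 hEq
  · simp only [mem_biUnion, mem_image, mem_erase, not_exists, not_and]
    rintro s - D hD h
    exact hD.1 (union_eq_empty.1 h).2

/-- A maximal chain of subsets of `X` adds the elements of `X` one at a time. -/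
theorem exists_equiv_of_chain {X : Type*} [Fintype X] {n : ℕ}
    (hn : Fintype.card X = n) (f : Fin (n + 1) → Finset X)
    (hf : ∀ i : Fin n, f i.castSucc ⊂ f i.succ) :
    ∃ p : X ≃ Fin n, ∀ i x, x ∈ f i ↔ (p x : ℕ) < i := by
  have hmono : Monotone f := (Fin.strictMono_iff_lt_succ.2 hf).monotone
  choose q hq hq' using fun i => Finset.exists_of_ssubset (hf i)
  have hlt : ∀ i j, i < j → q i ≠ q j := fun i j hij h =>
    hq' j (h ▸ hmono (Fin.succ_le_castSucc_iff.2 hij) (hq i))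
  have hinj : Function.Injective q := fun i j h => by
    rcases lt_trichotomy i j with h' | h' | h'
    · exact absurd h (hlt i j h')
    · exact h'
    · exact absurd h.symm (hlt j i h')
  have hbij : Function.Bijective q :=
    (Fintype.bijective_iff_injective_and_card q).2 ⟨hinj, by simp [hn]⟩
  refine ⟨(Equiv.ofBijective q hbij).symm, fun i x => ?_⟩
  obtain ⟨j, rfl⟩ := hbij.2 x
  rw [Equiv.ofBijective_symm_apply_apply]
  constructor
  · intro h
    by_contra hji
    exact hq' j (hmono (show i ≤ j.castSucc from Fin.le_def.2 (by simpa using hji)) h)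
  · intro h
    exact hmono (show j.succ ≤ i from Fin.le_def.2 (by simpa using h)) (hq j)

/-- The elements of a finite type can be listed with weakly increasing block index. -/
theorem exists_equiv_monotone {X α : Type*} [Fintype X] [LinearOrder α] {n : ℕ}
    (hn : Fintype.card X = n) (b : X → α) :
    ∃ p : X ≃ Fin n, Monotone (b ∘ p.symm) := by
  let e := Fintype.equivFinOfCardEq hn
  exact ⟨e.trans (Tuple.sort (b ∘ e.symm)).symm, Tuple.monotone_sort (b ∘ e.symm)⟩

/-- Maximal chains of the tower correspond to block-preserving permutations. -/
theorem card_chains_tower {X α : Type*} [Fintype X] [DecidableEq X] [Fintype α] [LinearOrder α]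
    {n : ℕ} (hn : Fintype.card X = n) (b : X → α) :
    Nat.card {f : Fin (n + 1) → Finset X //
        (∀ i, ∀ x ∈ f i, ∀ y ∉ f i, b x ≤ b y) ∧ ∀ i : Fin n, f i.castSucc ⊂ f i.succ}
      = ∏ i, (Fintype.card {x // b x = i}).factorial := by
  obtain ⟨p, hp⟩ := exists_equiv_monotone hn b
  rw [← DomMulAct.stabilizer_card, ← Nat.card_eq_fintype_card]
  symm
  refine Nat.card_eq_of_bijective (fun g => ⟨fun i => Finset.univ.filter
    fun x => (p (g.1 x) : ℕ) < i, ?_, ?_⟩) ⟨?_, ?_⟩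
  · intro i x hx y hy
    simp only [Finset.mem_filter, Finset.mem_univ, true_and, not_lt] at hx hy
    have h := hp (show p (g.1 x) ≤ p (g.1 y) from Fin.le_def.2 (hx.le.trans hy))
    have hg := fun z => congrFun g.2 z
    simp only [Function.comp_apply, Equiv.symm_apply_apply] at h hg
    rwa [hg, hg] at h
  · intro i
    rw [Finset.ssubset_iff_of_subset]
    · exact ⟨g.1.symm (p.symm i), by simp, by simp⟩
    · intro x hx
      simp only [Finset.mem_filter, Finset.mem_univ, true_and, Fin.val_castSucc,
        Fin.val_succ] at hx ⊢
      omega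
  · intro g h hgh
    have key : ∀ i : Fin (n + 1), ∀ x, (p (g.1 x) : ℕ) < i ↔ (p (h.1 x) : ℕ) < i := by
      intro i x
      simpa using Finset.ext_iff.1 (congrFun (Subtype.ext_iff.1 hgh) i) x
    refine Subtype.ext (Equiv.ext fun x => p.injective (Fin.ext ?_))
    have h1 := key (p (g.1 x)).succ x
    have h2 := key (p (h.1 x)).succ x
    simp only [Fin.val_succ] at h1 h2
    omega
  · rintro ⟨f, hfT, hf⟩
    obtain ⟨q, hq⟩ := exists_equiv_of_chain hn f hf
    have hqm : Monotone (b ∘ q.symm) := by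
      intro i j hij
      rcases hij.lt_or_eq with h | rfl
      · refine hfT j.castSucc _ ((hq _ _).2 ?_) _ (mt (hq _ _).1 ?_)
        · simpa using h
        · simp
      · exact le_rfl
    have hu := Tuple.unique_monotone (f := b ∘ p.symm) (σ := 1) (τ := q.symm.trans p)
      (by simpa using hp) (by convert hqm using 1; ext; simp)
    refine ⟨⟨q.trans p.symm, ?_⟩, ?_⟩
    · ext x
      simpa using congrFun hu (q x)
    · refine Subtype.ext (funext fun i => Finset.ext fun x => ?_)
      simp [hq]


/-- For `n = t·k` and a ground set `X` of size `n` partitioned into blocks `B 0, …, B (k−1)`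
of size `t` each, the tower of `t`-cubes
`𝒯_t = { A ⊆ X : B 0 ∪ ⋯ ∪ B (s−1) ⊆ A ⊆ B 0 ∪ ⋯ ∪ B s for some 0 ≤ s ≤ k−1 }`
satisfies `|𝒯_t| = k·(2^t − 1) + 1` and `c(𝒯_t) = (t!)^k`. -/
theorem stmt8 (t k : ℕ) (ht : 1 ≤ t) (hk : 1 ≤ k)
    (X : Type) [Fintype X] [DecidableEq X] (hcard : Fintype.card X = t * k)
    (B : Fin k → Finset X)
    (hdisj : ∀ i j, i ≠ j → Disjoint (B i) (B j))
    (hsize : ∀ i, (B i).card = t)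
    (hcover : ∀ x : X, ∃ i, x ∈ B i)
    (T : Set (Finset X))
    (hT : ∀ A : Finset X, A ∈ T ↔ ∃ s : ℕ, s ≤ k - 1 ∧
      (Finset.univ.filter fun i : Fin k => (i : ℕ) < s).biUnion B ⊆ A ∧
      A ⊆ (Finset.univ.filter fun i : Fin k => (i : ℕ) < s + 1).biUnion B) :
    Nat.card T = k * (2 ^ t - 1) + 1 ∧
    Nat.card {f : Fin (t * k + 1) → Finset X //
        (∀ i, f i ∈ T) ∧ ∀ i : Fin (t * k), f i.castSucc ⊂ f i.succ}
      = t.factorial ^ k := by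
  choose b hb using hcover
  have hmem : ∀ x i, x ∈ B i ↔ b x = i := by
    intro x i
    constructor
    · intro h
      by_contra hne
      exact Finset.disjoint_left.1 (hdisj _ _ hne) (hb x) h
    · rintro rfl
      exact hb x
  have hfib : ∀ i, Finset.univ.filter (fun x => b x = i) = B i := by
    intro i
    ext x
    simp [hmem]
  have hT' : ∀ A, A ∈ T ↔ ∀ x ∈ A, ∀ y ∉ A, b x ≤ b y := by
    intro A
    rw [hT]
    simp only [Finset.subset_iff, Finset.mem_biUnion, Finset.mem_filter, Finset.mem_univ,
      true_and, hmem, exists_eq_right']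
    constructor
    · rintro ⟨s, -, h1, h2⟩ x hx y hy
      have h3 := h2 hx
      have h4 : ¬ (b y : ℕ) < s := fun h => hy (h1 h)
      exact Fin.le_def.2 (by omega)
    · intro h
      rcases A.eq_empty_or_nonempty with rfl | hne
      · exact ⟨0, by simp⟩
      · obtain ⟨m, hm, hmax⟩ := A.exists_max_image b hne
        refine ⟨b m, by omega, fun x hx => ?_, fun x hx => ?_⟩
        · by_contra hxA
          exact absurd (Fin.le_def.1 (h m hm x hxA)) (not_le.2 hx)
        · exact Nat.lt_succ_of_le (hmax x hx)
  constructor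
  · rw [← card_tower b (t := t) (fun i => by rw [hfib, hsize])]
    exact Nat.subtype_card _ (by simp [hT'])
  · simp only [hT']
    rw [card_chains_tower hcard b]
    simp [Fintype.card_subtype, hfib, hsize]
end

section
/- Let n be a positive integer divisible by 3 and let 𝒜 ⊆ 2^{[n]} be a set system. Then c(𝒜) ≤ |𝒜|² · ((n/3)!)³. -/
open Classical in
/-- Strict chains `A = f 0 ⊂ f 1 ⊂ ⋯ ⊂ f k = B` of finite sets. -/
noncomputable def strictChains {α : Type*} [Fintype α] (k : ℕ) (A B : Finset α) :
    Finset (Fin (k + 1) → Finset α) :=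
  {f | f 0 = A ∧ f (Fin.last k) = B ∧ ∀ i : Fin k, f i.castSucc ⊂ f i.succ}

theorem card_add_sub_le_of_ssubset_succ {α : Type*} {k : ℕ} {f : Fin (k + 1) → Finset α}
    (hf : ∀ i : Fin k, f i.castSucc ⊂ f i.succ) {i j : ℕ} (hij : i ≤ j) (hj : j < k + 1) :
    (f ⟨i, by omega⟩).card + (j - i) ≤ (f ⟨j, hj⟩).card := by
  induction j, hij using Nat.le_induction with
  | base => simp
  | succ j hij ih =>
    have h₁ := ih (by omega)
    have h₂ := Finset.card_lt_card (hf ⟨j, by omega⟩)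
    simp only [Fin.castSucc_mk, Fin.succ_mk] at h₂
    omega

theorem card_strictChains_le {α : Type*} [Fintype α] (k : ℕ) (A B : Finset α)
    (h : B.card ≤ A.card + k) : (strictChains k A B).card ≤ k.factorial := by
  classical
  induction k generalizing A with
  | zero =>
    rw [Nat.factorial_zero, Finset.card_le_one]
    intro f hf g hg
    simp only [strictChains, Finset.mem_filter] at hf hg
    funext i
    rw [Fin.fin_one_eq_zero i, hf.2.1, hg.2.1]
  | succ k ih =>
    by_cases hAB : A ⊆ B
    swap
    · have : strictChains (k + 1) A B = ∅ := by
        refine Finset.eq_empty_of_forall_notMem fun f hf => hAB ?_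
        simp only [strictChains, Finset.mem_filter] at hf
        obtain ⟨-, rfl, rfl, hf⟩ := hf
        exact (Fin.strictMono_iff_lt_succ.2 hf).monotone (Fin.zero_le _)
      simp [this]
    have hmaps : ∀ f ∈ strictChains (k + 1) A B,
        f 1 ∈ (B \ A).image (fun x => insert x A) := by
      intro f hf
      simp only [strictChains, Finset.mem_filter] at hf
      obtain ⟨-, rfl, rfl, hf⟩ := hf
      have h₀ : f 0 ⊂ f 1 := hf 0
      have h₁ : f 1 ⊆ f (Fin.last (k + 1)) :=
        (Fin.strictMono_iff_lt_succ.2 hf).monotone (Fin.le_last _)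
      have h₂ : (f 1).card + (k + 1 - 1) ≤ (f (Fin.last (k + 1))).card :=
        card_add_sub_le_of_ssubset_succ hf (i := 1) (j := k + 1) (by omega) (by omega)
      obtain ⟨x, hx₁, hx₀⟩ := Finset.exists_of_ssubset h₀
      refine Finset.mem_image.2 ⟨x, Finset.mem_sdiff.2 ⟨h₁ hx₁, hx₀⟩, ?_⟩
      refine Finset.eq_of_subset_of_card_le (Finset.insert_subset hx₁ h₀.1) ?_
      rw [Finset.card_insert_of_notMem hx₀]
      omega
    have hfib : ∀ C ∈ (B \ A).image (fun x => insert x A),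
        {f ∈ strictChains (k + 1) A B | f 1 = C}.card ≤ k.factorial := by
      intro C hC
      obtain ⟨x, hx, rfl⟩ := Finset.mem_image.1 hC
      have hx := (Finset.mem_sdiff.1 hx).2
      refine le_trans (Finset.card_le_card_of_injOn Fin.tail ?_ ?_)
        (ih (insert x A) (by rw [Finset.card_insert_of_notMem hx]; omega))
      · intro f hf
        simp only [strictChains, Finset.coe_filter, Set.mem_ofPred_eq, Finset.mem_filter] at hf ⊢
        obtain ⟨⟨-, -, hl, hf⟩, h₁⟩ := hf
        exact ⟨Finset.mem_univ _, h₁, hl, fun i => hf i.succ⟩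
      · intro f hf g hg hfg
        simp only [strictChains, Finset.coe_filter, Set.mem_ofPred_eq, Finset.mem_filter] at hf hg
        rw [← Fin.cons_self_tail f, ← Fin.cons_self_tail g, hfg, hf.1.2.1, hg.1.2.1]
    refine (Finset.card_le_mul_card_image_of_maps_to hmaps _ hfib).trans ?_
    rw [Nat.factorial_succ, mul_comm]
    refine Nat.mul_le_mul_right _ (Finset.card_image_le.trans ?_)
    rw [Finset.card_sdiff_of_subset hAB]
    omega

/-- For `n` a positive multiple of 3 and `𝒜 ⊆ 2^{[n]}`: `c(𝒜) ≤ |𝒜|² · ((n/3)!)³`. -/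
theorem stmt9 (n : ℕ) (hn : 0 < n) (h3 : 3 ∣ n) (𝒜 : Finset (Finset (Fin n))) :
    chainCount n 𝒜 ≤ 𝒜.card ^ 2 * (n / 3).factorial ^ 3 := by
  classical
  obtain ⟨m, rfl⟩ := h3
  rw [Nat.mul_div_cancel_left m (by norm_num), chainCount, Nat.card_eq_fintype_card,
    Fintype.card_subtype]
  have hmaps : ∀ f ∈ ({f | (∀ i, f i ∈ 𝒜) ∧ ∀ i : Fin (3 * m), f i.castSucc ⊂ f i.succ} :
        Finset (Fin (3 * m + 1) → Finset (Fin (3 * m)))),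
      (f ⟨m, by omega⟩, f ⟨2 * m, by omega⟩) ∈ 𝒜 ×ˢ 𝒜 := by
    intro f hf
    have hf := (Finset.mem_filter.1 hf).2.1
    exact Finset.mk_mem_product (hf _) (hf _)
  refine (Finset.card_le_mul_card_image_of_maps_to hmaps (m.factorial ^ 3) ?_).trans ?_
  swap
  · rw [Finset.card_product, mul_comm, sq]
  rintro ⟨A, B⟩ -
  have hcard : ∀ f : Fin (3 * m + 1) → Finset (Fin (3 * m)),
      (∀ i : Fin (3 * m), f i.castSucc ⊂ f i.succ) → ∀ i : Fin (3 * m + 1), (f i).card = i := by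
    intro f hf i
    have h₀ := card_add_sub_le_of_ssubset_succ hf (Nat.zero_le i) i.2
    have h₁ := card_add_sub_le_of_ssubset_succ hf (Nat.le_of_lt_succ i.2) (Nat.lt_succ_self _)
    have h₂ := Finset.card_le_univ (f ⟨3 * m, Nat.lt_succ_self _⟩)
    rw [Fintype.card_fin] at h₂
    have := i.2
    simp only [Fin.eta] at h₀ h₁
    omega
  rcases Finset.eq_empty_or_nonempty (Finset.filter (fun f => (f ⟨m, by omega⟩,
    f ⟨2 * m, by omega⟩) = (A, B)) ({f | (∀ i, f i ∈ 𝒜) ∧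
      ∀ i : Fin (3 * m), f i.castSucc ⊂ f i.succ} :
        Finset (Fin (3 * m + 1) → Finset (Fin (3 * m))))) with h | ⟨g, hg⟩
  · rw [h]; simp
  simp only [Finset.mem_filter, Finset.mem_univ, true_and, Prod.mk.injEq] at hg
  have hA : A.card = m := by rw [← hg.2.1, hcard g hg.1.2]
  have hB : B.card = 2 * m := by rw [← hg.2.2, hcard g hg.1.2]
  have hbound : (strictChains m ∅ A ×ˢ strictChains m A B ×ˢ
      strictChains m B Finset.univ).card ≤ m.factorial ^ 3 := by
    rw [Finset.card_product, Finset.card_product, pow_succ', sq]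
    refine Nat.mul_le_mul (card_strictChains_le _ _ _ ?_)
      (Nat.mul_le_mul (card_strictChains_le _ _ _ ?_) (card_strictChains_le _ _ _ ?_))
    · simp [hA]
    · omega
    · rw [Finset.card_univ, Fintype.card_fin]; omega
  refine le_trans (Finset.card_le_card_of_injOn (fun f =>
    (fun i : Fin (m + 1) => f ⟨i, by omega⟩, fun i : Fin (m + 1) => f ⟨m + i, by omega⟩,
      fun i : Fin (m + 1) => f ⟨2 * m + i, by omega⟩)) ?_ ?_) hbound
  · intro f hf
    simp only [Finset.coe_filter, Finset.mem_filter, Finset.mem_univ, true_and, Prod.mk.injEq,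
      Set.mem_ofPred_eq] at hf
    obtain ⟨⟨-, hf⟩, rfl, rfl⟩ := hf
    simp only [strictChains, Finset.coe_product, Set.mem_prod, Finset.coe_filter,
      Finset.mem_univ, true_and, Set.mem_ofPred_eq]
    refine ⟨⟨?_, rfl, fun i => hf ⟨i, by omega⟩⟩,
      ⟨rfl, ?_, fun i => hf ⟨m + i, by omega⟩⟩,
      rfl, ?_, fun i => hf ⟨2 * m + i, by omega⟩⟩
    · rw [← Finset.card_eq_zero, hcard f hf]; rfl
    · congr 2; simp only [Fin.val_last]; omega
    · rw [← Finset.card_eq_iff_eq_univ, hcard f hf, Fintype.card_fin]; simp only [Fin.val_last]; omega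
  · intro f _ g _ hfg
    simp only [Prod.mk.injEq] at hfg
    obtain ⟨h₁, h₂, h₃⟩ := hfg
    funext ⟨i, hi⟩
    rcases le_or_gt i m with h | h
    · exact congrFun h₁ ⟨i, by omega⟩
    rcases le_or_gt i (2 * m) with h' | h'
    · have := congrFun h₂ ⟨i - m, by omega⟩
      simpa only [Nat.add_sub_cancel' h.le] using this
    · have := congrFun h₃ ⟨i - 2 * m, by omega⟩
      simpa only [Nat.add_sub_cancel' h'.le] using this
end

section
/- Let n ≥ 3 be divisible by 3 and let 𝒜 ⊆ 2^{[n]} be a nonempty set system. Then η(𝒜) ≤ (1 + 6·log₂ n / n)/3. -/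
/-- A maximal chain of subsets of `[n]` is the chain of initial segments of a permutation. -/
lemma exists_perm_mem_chain_iff {n : ℕ} {f : Fin (n + 1) → Finset (Fin n)}
    (hf : ∀ i : Fin n, f i.castSucc ⊂ f i.succ) :
    ∃ σ : Equiv.Perm (Fin n), ∀ x j, σ x ∈ f j ↔ x.castSucc < j := by
  have hmono : Monotone f := (Fin.strictMono_iff_lt_succ.mpr hf).monotone
  choose g hg using fun i => Finset.exists_of_ssubset (hf i)
  have hmem : ∀ x j, g x ∈ f j ↔ x.castSucc < j := fun x j => by
    refine ⟨fun h => ?_, fun h => hmono (Fin.castSucc_lt_iff_succ_le.mp h) (hg x).1⟩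
    by_contra! hj
    exact (hg x).2 (hmono hj h)
  have hinj : Function.Injective g := fun x y hxy => by
    have h : ∀ j, x.castSucc < j ↔ y.castSucc < j := fun j => by rw [← hmem, ← hmem, hxy]
    have h1 := (h y.succ).mpr Fin.castSucc_lt_succ
    have h2 := (h x.succ).mp Fin.castSucc_lt_succ
    simp only [Fin.lt_def, Fin.val_castSucc, Fin.val_succ] at h1 h2
    ext
    omega
  exact ⟨Equiv.ofBijective g (Finite.injective_iff_bijective.mp hinj), hmem⟩

/-- The permutations carrying the colouring `d` to a fixed colouring `c` are at most as many as
those preserving `d`. -/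
lemma card_perm_comp_eq_le {α ι : Type*} [Fintype α] [DecidableEq α] [Fintype ι] [DecidableEq ι]
    (c d : α → ι) :
    Fintype.card {σ : Equiv.Perm α // c ∘ σ = d} ≤
      ∏ i, (Fintype.card {a // d a = i}).factorial := by
  classical
  rw [← DomMulAct.stabilizer_card d]
  rcases isEmpty_or_nonempty {σ : Equiv.Perm α // c ∘ σ = d} with h | ⟨⟨σ₀, h₀⟩⟩
  · simp
  refine Fintype.card_le_of_injective
    (fun σ => ⟨σ₀⁻¹ * σ.1, ?_⟩) fun σ τ h => ?_
  · funext x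
    have := congrFun σ.2 x
    simpa [← h₀] using this
  · simpa [Subtype.ext_iff] using h

lemma card_divNat_fiber (k m : ℕ) (i : Fin k) :
    Fintype.card {a : Fin (k * m) // a.divNat = i} = m := by
  have e : {a : Fin (k * m) // a.divNat = i} ≃ {p : Fin k × Fin m // p.1 = i} :=
    finProdFinEquiv.symm.subtypeEquiv fun a => Iff.rfl
  rw [Fintype.card_congr (e.trans (Equiv.prodSubtypeFstEquivSubtypeProd.trans
    (Equiv.uniqueProd (Fin m) {a : Fin k // a = i}))), Fintype.card_fin]

/-- Recording where a chain passes through levels `m` and `2m` leaves at most `(m!)³` chains. -/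
lemma chainCount_three_mul_le (m : ℕ) (𝒜 : Finset (Finset (Fin (3 * m)))) :
    chainCount (3 * m) 𝒜 ≤ 𝒜.card ^ 2 * m.factorial ^ 3 := by
  classical
  unfold chainCount
  rw [Nat.card_eq_fintype_card, ← Finset.card_univ]
  set X := {f : Fin (3 * m + 1) → Finset (Fin (3 * m)) //
    (∀ i, f i ∈ 𝒜) ∧ ∀ i : Fin (3 * m), f i.castSucc ⊂ f i.succ}
  choose σ hσ using fun f : X => exists_perm_mem_chain_iff f.2.2
  have hσinj : Function.Injective σ := fun f g h => by
    refine Subtype.ext (funext fun j => Finset.ext fun x => ?_)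
    have h1 := hσ f ((σ f).symm x) j
    have h2 := hσ g ((σ f).symm x) j
    rw [← h] at h2
    rw [Equiv.apply_symm_apply] at h1 h2
    exact h1.trans h2.symm
  let mid : X → Finset (Fin (3 * m)) × Finset (Fin (3 * m)) :=
    fun f => (f.1 ⟨m, by omega⟩, f.1 ⟨2 * m, by omega⟩)
  have himage : (Finset.univ.image mid).card ≤ 𝒜.card ^ 2 := by
    rw [sq, ← Finset.card_product]
    refine Finset.card_le_card fun p hp => ?_
    obtain ⟨f, -, rfl⟩ := Finset.mem_image.mp hp
    exact Finset.mem_product.mpr ⟨f.2.1 _, f.2.1 _⟩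
  have hfiber : ∀ p ∈ Finset.univ.image mid,
      (Finset.univ.filter fun f => mid f = p).card ≤ m.factorial ^ 3 := fun p _ => by
    let c : Fin (3 * m) → Fin 3 := fun x => if x ∈ p.1 then 0 else if x ∈ p.2 then 1 else 2
    have hc : ∀ f, mid f = p → c ∘ σ f = Fin.divNat := by
      rintro f rfl
      funext x
      have hx := x.2
      have hm : 0 < m := by omega
      simp only [c, mid, Function.comp_apply, hσ, Fin.lt_def, Fin.val_castSucc]
      ext
      rw [Fin.coe_divNat]
      split_ifs with h1 h2
      · simp [Nat.div_eq_of_lt h1]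
      · symm
        rw [Nat.div_eq_iff hm]
        simp
        omega
      · symm
        rw [Nat.div_eq_iff hm]
        simp
        omega
    have hle := card_perm_comp_eq_le c (Fin.divNat (n := m))
    simp only [card_divNat_fiber, Finset.prod_const, Finset.card_univ, Fintype.card_fin] at hle
    refine le_trans ?_ hle
    rw [← Fintype.card_subtype]
    exact Fintype.card_le_of_injective (fun f => ⟨σ f.1, hc f.1 f.2⟩) fun f g h =>
      Subtype.ext (hσinj (congrArg Subtype.val h))
  calc _ ≤ m.factorial ^ 3 * (Finset.univ.image mid).card :=
        Finset.card_le_mul_card_image _ _ hfiber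
    _ ≤ _ := by rw [mul_comm]; gcongr

lemma three_pow_mul_factorial_le (m : ℕ) :
    3 ^ (3 * m) * m.factorial ^ 3 ≤ (3 * m + 1) ^ 2 * (3 * m).factorial := by
  induction m with
  | zero => simp
  | succ m ih =>
    have h : (3 * (m + 1)).factorial =
        (3 * m + 3) * ((3 * m + 2) * ((3 * m + 1) * (3 * m).factorial)) := by
      simp [Nat.mul_add, Nat.factorial_succ]
    rw [h, Nat.factorial_succ]
    calc _ = 27 * (m + 1) ^ 3 * (3 ^ (3 * m) * m.factorial ^ 3) := by ring
      _ ≤ 27 * (m + 1) ^ 3 * ((3 * m + 1) ^ 2 * (3 * m).factorial) := by gcongr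
      _ = (3 * m + 3) * (3 * m + 1) * (3 * m).factorial *
          ((3 * m + 3) ^ 2 * (3 * m + 1)) := by ring
      _ ≤ (3 * m + 3) * (3 * m + 1) * (3 * m).factorial *
          ((3 * m + 4) ^ 2 * (3 * m + 2)) := by gcongr <;> omega
      _ = _ := by ring

lemma sq_succ_le_two_pow {n : ℕ} (hn : 6 ≤ n) : (n + 1) ^ 2 ≤ 2 ^ n := by
  induction n, hn using Nat.le_induction with
  | base => norm_num
  | succ n hn ih => rw [pow_succ 2]; nlinarith

lemma sq_succ_le_one_add_logb_pow {n : ℕ} (hn : 3 ≤ n) (h3 : 3 ∣ n) :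
    ((n : ℝ) + 1) ^ 2 ≤ (1 + 6 * Real.logb 2 n / n) ^ n := by
  have hn' : (3 : ℝ) ≤ n := by exact_mod_cast hn
  rcases eq_or_lt_of_le hn with rfl | hlt
  · have h : 1 ≤ Real.logb 2 3 := by
      rw [Real.le_logb_iff_rpow_le (by norm_num) (by norm_num)]; norm_num
    push_cast
    calc ((3 : ℝ) + 1) ^ 2 ≤ 3 ^ 3 := by norm_num
      _ ≤ _ := by gcongr; linarith
  have h6 : 6 ≤ n := by omega
  set t := 6 * Real.logb 2 n / n with ht
  have ht0 : 0 ≤ t := by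
    have := Real.logb_nonneg (b := 2) (by norm_num) (show (1 : ℝ) ≤ n by linarith)
    positivity
  rcases le_total 1 t with h1 | h1
  · calc ((n : ℝ) + 1) ^ 2 ≤ 2 ^ n := by exact_mod_cast sq_succ_le_two_pow h6
      _ ≤ _ := by gcongr; linarith
  · have h2t : (2 : ℝ) ^ t ≤ 1 + t := by
      have := rpow_one_add_le_one_add_mul_self (s := 1) (by norm_num) ht0 h1
      norm_num at this
      exact this
    have hpow : ((2 : ℝ) ^ t) ^ n = (n : ℝ) ^ 6 := by
      rw [← Real.rpow_mul_natCast (by norm_num), ht,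
        div_mul_cancel₀ _ (by positivity : (n : ℝ) ≠ 0), mul_comm, Real.rpow_mul (by norm_num),
        Real.rpow_logb (by norm_num) (by norm_num) (by positivity)]
      exact_mod_cast rfl
    calc ((n : ℝ) + 1) ^ 2 ≤ ((n : ℝ) ^ 3) ^ 2 := by
          gcongr
          nlinarith [sq_nonneg ((n : ℝ) - 1), pow_le_pow_left₀ (by norm_num) hn' 2]
      _ = ((2 : ℝ) ^ t) ^ n := by rw [hpow]; ring
      _ ≤ _ := by gcongr

/-- For `n ≥ 3` divisible by 3 and a nonempty set system `𝒜 ⊆ 2^{[n]}`: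
`η(𝒜) ≤ (1 + 6·log₂ n / n)/3`. -/
theorem stmt10 (n : ℕ) (hn : 3 ≤ n) (h3 : 3 ∣ n)
    (𝒜 : Finset (Finset (Fin n))) (hne : 𝒜.Nonempty) :
    eta n 𝒜 ≤ (1 + 6 * Real.logb 2 n / n) / 3 := by
  have hbound := sq_succ_le_one_add_logb_pow hn h3
  have hlog : 0 ≤ Real.logb 2 n :=
    Real.logb_nonneg (by norm_num) (by exact_mod_cast (by omega : 1 ≤ n))
  have hcard : (0 : ℝ) < 𝒜.card := by exact_mod_cast hne.card_pos
  have hratio : (chainCount n 𝒜 : ℝ) / ((𝒜.card : ℝ) ^ 2 * n.factorial) ≤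
      ((n : ℝ) + 1) ^ 2 / 3 ^ n := by
    obtain ⟨m, rfl⟩ := h3
    have h1 : (chainCount (3 * m) 𝒜 : ℝ) ≤ (𝒜.card : ℝ) ^ 2 * (m.factorial : ℝ) ^ 3 := by
      exact_mod_cast chainCount_three_mul_le m 𝒜
    have h2 : (3 : ℝ) ^ (3 * m) * (m.factorial : ℝ) ^ 3 ≤
        (((3 * m : ℕ) : ℝ) + 1) ^ 2 * (3 * m).factorial := by
      exact_mod_cast three_pow_mul_factorial_le m
    rw [div_le_div_iff₀ (by positivity) (by positivity)]
    calc _ ≤ (𝒜.card : ℝ) ^ 2 * (m.factorial : ℝ) ^ 3 * 3 ^ (3 * m) := by gcongr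
      _ = (𝒜.card : ℝ) ^ 2 * (3 ^ (3 * m) * (m.factorial : ℝ) ^ 3) := by ring
      _ ≤ (𝒜.card : ℝ) ^ 2 * ((((3 * m : ℕ) : ℝ) + 1) ^ 2 * (3 * m).factorial) := by gcongr
      _ = _ := by ring
  unfold eta
  rw [one_div, Real.rpow_inv_le_iff_of_pos (by positivity) (by positivity)
    (by exact_mod_cast (by omega : 0 < n)), Real.rpow_natCast, div_pow]
  exact hratio.trans (by gcongr)
end

section
/- Let U be a finite set with |U| = n ≥ 1, let δ ∈ (0, 1/2], and let 𝒳, 𝒴 ⊆ 2^U be nonempty families with |𝒳| ≥ 2^{h(δ)·n} and |𝒴| ≥ 2^{h(δ)·n}. Then there exist A ∈ 𝒳 and B ∈ 𝒴 such that |A △ B| ≤ n − 2·⌊δn⌋ (where A △ B denotes the symmetric difference); in particular the Hamming distance between 𝒳 and 𝒴 is at most (1 − 2δ)n + 2. -/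
/-- The binary entropy function `h(p) = −p·log₂ p − (1−p)·log₂(1−p)` (with `h(0) = h(1) = 0`,
using the convention `log₂ 0 = 0`). -/
noncomputable def binEnt (p : ℝ) : ℝ :=
  -p * Real.logb 2 p - (1 - p) * Real.logb 2 (1 - p)

lemma add_mul_add_le_of_cross_le {r x₀ x₁ y₀ y₁ M : ℝ} (hr : 0 < r) (hM : 0 < M)
    (hx₀ : 0 ≤ x₀) (hy₀ : 0 ≤ y₀)
    (h₀₀ : x₀ * y₀ ≤ M) (h₁₁ : x₁ * y₁ ≤ M) (h₀₁ : x₀ * y₁ ≤ r * M) (h₁₀ : x₁ * y₀ ≤ r * M) :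
    (x₀ + x₁) * (y₀ + y₁) ≤ (1 + r) ^ 2 / r * M := by
  rw [div_mul_eq_mul_div, le_div_iff₀ hr]
  have hprod : (x₀ * y₀) * (x₁ * y₁) ≤ M * M :=
    (mul_le_mul_of_nonneg_left h₁₁ (mul_nonneg hx₀ hy₀)).trans
      (mul_le_mul_of_nonneg_right h₀₀ hM.le)
  have hcross : 0 ≤ (r * M - x₀ * y₁) * (r * M - x₁ * y₀) :=
    mul_nonneg (sub_nonneg.2 h₀₁) (sub_nonneg.2 h₁₀)
  have hsum : (x₀ * y₁ + x₁ * y₀) * r ≤ (r ^ 2 + 1) * M := by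
    refine le_of_mul_le_mul_left ?_ hM
    nlinarith
  nlinarith

lemma card_memberSubfamily_add_card_nonMemberSubfamily_cast {α : Type*} [DecidableEq α]
    (a : α) (𝒜 : Finset (Finset α)) :
    (𝒜.card : ℝ) = (𝒜.nonMemberSubfamily a).card + (𝒜.memberSubfamily a).card := by
  rw [← Finset.card_memberSubfamily_add_card_nonMemberSubfamily a 𝒜]
  push_cast
  ring

/-- Families at Hamming distance at least `D` satisfy an exponential trade-off between the product
of their sizes and `D`. -/
lemma card_mul_card_mul_pow_le {α : Type*} [DecidableEq α] {r : ℝ} (hr : 1 ≤ r)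
    (s : Finset α) : ∀ (𝒳 𝒴 : Finset (Finset α)) (D : ℕ), (∀ A ∈ 𝒳, A ⊆ s) → (∀ B ∈ 𝒴, B ⊆ s) →
      (∀ A ∈ 𝒳, ∀ B ∈ 𝒴, D ≤ (symmDiff A B).card) →
      (𝒳.card : ℝ) * 𝒴.card * r ^ D ≤ ((1 + r) ^ 2 / r) ^ s.card := by
  have hr0 : 0 < r := by linarith
  induction s using Finset.induction_on with
  | empty =>
    intro 𝒳 𝒴 D hX hY hD
    rcases 𝒳.eq_empty_or_nonempty with rfl | ⟨A, hA⟩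
    · simp
    rcases 𝒴.eq_empty_or_nonempty with rfl | ⟨B, hB⟩
    · simp
    have hX1 : 𝒳.card ≤ 1 := Finset.card_le_one.2 fun P hP Q hQ => by
      rw [Finset.subset_empty.1 (hX P hP), Finset.subset_empty.1 (hX Q hQ)]
    have hY1 : 𝒴.card ≤ 1 := Finset.card_le_one.2 fun P hP Q hQ => by
      rw [Finset.subset_empty.1 (hY P hP), Finset.subset_empty.1 (hY Q hQ)]
    have hD0 : D = 0 := by
      have := hD A hA B hB
      rw [Finset.subset_empty.1 (hX A hA), Finset.subset_empty.1 (hY B hB)] at this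
      simpa using this
    subst hD0
    have : 𝒳.card * 𝒴.card ≤ 1 := Nat.mul_le_mul hX1 hY1
    simpa using (by exact_mod_cast this : (𝒳.card : ℝ) * 𝒴.card ≤ 1)
  | insert a s ha ih =>
    intro 𝒳 𝒴 D hX hY hD
    have sub_non : ∀ 𝒜 : Finset (Finset α), (∀ A ∈ 𝒜, A ⊆ insert a s) →
        ∀ A ∈ 𝒜.nonMemberSubfamily a, A ⊆ s := by
      intro 𝒜 h A hA
      rw [Finset.mem_nonMemberSubfamily] at hA
      exact (Finset.subset_insert_iff_of_notMem hA.2).1 (h A hA.1)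
    have sub_mem : ∀ 𝒜 : Finset (Finset α), (∀ A ∈ 𝒜, A ⊆ insert a s) →
        ∀ A ∈ 𝒜.memberSubfamily a, A ⊆ s := by
      intro 𝒜 h A hA
      rw [Finset.mem_memberSubfamily] at hA
      exact (Finset.insert_subset_insert_iff hA.2).1 (h _ hA.1)
    have h₀₀ := ih (𝒳.nonMemberSubfamily a) (𝒴.nonMemberSubfamily a) D
      (sub_non 𝒳 hX) (sub_non 𝒴 hY) (by
        intro A hA B hB
        rw [Finset.mem_nonMemberSubfamily] at hA hB
        exact hD A hA.1 B hB.1)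
    have h₁₁ := ih (𝒳.memberSubfamily a) (𝒴.memberSubfamily a) D
      (sub_mem 𝒳 hX) (sub_mem 𝒴 hY) (by
        intro A hA B hB
        rw [Finset.mem_memberSubfamily] at hA hB
        refine (hD _ hA.1 _ hB.1).trans (Finset.card_le_card ?_)
        intro x hx
        simp only [Finset.mem_symmDiff, Finset.mem_insert] at hx ⊢
        tauto)
    have h₀₁ := ih (𝒳.nonMemberSubfamily a) (𝒴.memberSubfamily a) (D - 1)
      (sub_non 𝒳 hX) (sub_mem 𝒴 hY) (by
        intro A hA B hB
        rw [Finset.mem_nonMemberSubfamily] at hA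
        rw [Finset.mem_memberSubfamily] at hB
        rw [Nat.sub_le_iff_le_add]
        refine (hD _ hA.1 _ hB.1).trans ((Finset.card_le_card ?_).trans
          (Finset.card_insert_le a _))
        intro x hx
        simp only [Finset.mem_symmDiff, Finset.mem_insert] at hx ⊢
        tauto)
    have h₁₀ := ih (𝒳.memberSubfamily a) (𝒴.nonMemberSubfamily a) (D - 1)
      (sub_mem 𝒳 hX) (sub_non 𝒴 hY) (by
        intro A hA B hB
        rw [Finset.mem_memberSubfamily] at hA
        rw [Finset.mem_nonMemberSubfamily] at hB
        rw [Nat.sub_le_iff_le_add]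
        refine (hD _ hA.1 _ hB.1).trans ((Finset.card_le_card ?_).trans
          (Finset.card_insert_le a _))
        intro x hx
        simp only [Finset.mem_symmDiff, Finset.mem_insert] at hx ⊢
        tauto)
    have hpow : r ^ D ≤ r * r ^ (D - 1) := by
      rw [← pow_succ']
      exact pow_le_pow_right₀ hr (by omega)
    rw [Finset.card_insert_of_notMem ha, pow_succ',
      card_memberSubfamily_add_card_nonMemberSubfamily_cast a 𝒳,
      card_memberSubfamily_add_card_nonMemberSubfamily_cast a 𝒴]
    set x₀ : ℝ := ((𝒳.nonMemberSubfamily a).card : ℝ)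
    set x₁ : ℝ := ((𝒳.memberSubfamily a).card : ℝ)
    set y₀ : ℝ := ((𝒴.nonMemberSubfamily a).card : ℝ)
    set y₁ : ℝ := ((𝒴.memberSubfamily a).card : ℝ)
    have hx₀ : 0 ≤ x₀ := Nat.cast_nonneg _
    have hx₁ : 0 ≤ x₁ := Nat.cast_nonneg _
    have hy₀ : 0 ≤ y₀ := Nat.cast_nonneg _
    have hy₁ : 0 ≤ y₁ := Nat.cast_nonneg _
    have cross : ∀ {x y M : ℝ}, 0 ≤ x → 0 ≤ y → x * y * r ^ (D - 1) ≤ M →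
        x * (y * r ^ D) ≤ r * M := by
      intro x y M hx hy h
      calc x * (y * r ^ D) ≤ x * (y * (r * r ^ (D - 1))) := by gcongr
        _ = r * (x * y * r ^ (D - 1)) := by ring
        _ ≤ r * M := by gcongr
    have key := add_mul_add_le_of_cross_le (x₀ := x₀) (x₁ := x₁) (y₀ := y₀ * r ^ D)
      (y₁ := y₁ * r ^ D) (M := ((1 + r) ^ 2 / r) ^ s.card) hr0 (by positivity) hx₀ (by positivity)
      (by rwa [← mul_assoc]) (by rwa [← mul_assoc])
      (cross hx₀ hy₁ h₀₁) (cross hx₁ hy₀ h₁₀)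
    calc (x₀ + x₁) * (y₀ + y₁) * r ^ D
        = (x₀ + x₁) * (y₀ * r ^ D + y₁ * r ^ D) := by ring
      _ ≤ _ := key

lemma binEnt_mul_log_two (p : ℝ) :
    binEnt p * Real.log 2 = -p * Real.log p - (1 - p) * Real.log (1 - p) := by
  have : Real.log 2 ≠ 0 := (Real.log_pos one_lt_two).ne'
  unfold binEnt Real.logb
  field_simp

lemma binEnt_one_half : binEnt (1 / 2) = 1 := by
  have h2 : Real.log 2 ≠ 0 := (Real.log_pos one_lt_two).ne'
  refine mul_right_cancel₀ h2 ?_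
  rw [binEnt_mul_log_two, show (1 : ℝ) - 1 / 2 = 2⁻¹ by norm_num, one_div, Real.log_inv]
  ring

/-- Two families of size at least `2 ^ (h(δ) n)` contain members at distance at most
`(1 - 2δ) n`. -/
lemma exists_card_symmDiff_le {U : Type*} [Fintype U] [DecidableEq U] {δ : ℝ}
    (hδ0 : 0 < δ) (hδ1 : δ ≤ 1 / 2) {𝒳 𝒴 : Finset (Finset U)}
    (h𝒳 : (2 : ℝ) ^ (binEnt δ * Fintype.card U) ≤ 𝒳.card)
    (h𝒴 : (2 : ℝ) ^ (binEnt δ * Fintype.card U) ≤ 𝒴.card) :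
    ∃ A ∈ 𝒳, ∃ B ∈ 𝒴, ((symmDiff A B).card : ℝ) ≤ (1 - 2 * δ) * Fintype.card U := by
  rcases hδ1.eq_or_lt with rfl | hlt
  · have full : ∀ 𝒜 : Finset (Finset U),
        (2 : ℝ) ^ (binEnt (1 / 2) * Fintype.card U) ≤ 𝒜.card → 𝒜 = Finset.univ := by
      intro 𝒜 h
      rw [binEnt_one_half, one_mul, Real.rpow_natCast] at h
      refine Finset.eq_univ_of_card _ (le_antisymm (Finset.card_le_univ _) ?_)
      rw [Fintype.card_finset]
      exact_mod_cast h
    refine ⟨∅, by simp [full 𝒳 h𝒳], ∅, by simp [full 𝒴 h𝒴], by simp⟩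
  by_contra! hfar
  set n := Fintype.card U
  have hx : (0 : ℝ) < 𝒳.card := (by positivity : (0 : ℝ) < _).trans_le h𝒳
  have hy : (0 : ℝ) < 𝒴.card := (by positivity : (0 : ℝ) < _).trans_le h𝒴
  have hδ' : 0 < 1 - δ := by linarith
  have hr : 1 < (1 - δ) / δ := by rw [lt_div_iff₀ hδ0]; linarith
  obtain ⟨p, hp, hmin⟩ := Finset.exists_min_image (𝒳 ×ˢ 𝒴) (fun p => (symmDiff p.1 p.2).card)
    ((Finset.card_pos.1 (by exact_mod_cast hx)).product
      (Finset.card_pos.1 (by exact_mod_cast hy)))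
  rw [Finset.mem_product] at hp
  have hD := hfar p.1 hp.1 p.2 hp.2
  have key := card_mul_card_mul_pow_le hr.le Finset.univ 𝒳 𝒴 (symmDiff p.1 p.2).card
    (fun A _ => A.subset_univ) (fun B _ => B.subset_univ)
    (fun A hA B hB => hmin (A, B) (Finset.mk_mem_product hA hB))
  set D := (symmDiff p.1 p.2).card
  have hK : (1 + (1 - δ) / δ) ^ 2 / ((1 - δ) / δ) = (δ * (1 - δ))⁻¹ := by
    field_simp
    ring
  rw [hK, Finset.card_univ] at key
  have hlog := Real.log_le_log (by positivity) key
  rw [Real.log_mul (by positivity) (by positivity), Real.log_mul hx.ne' hy.ne', Real.log_pow,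
    Real.log_pow, Real.log_inv, Real.log_mul hδ0.ne' hδ'.ne'] at hlog
  have hX := Real.log_le_log (by positivity) h𝒳
  have hY := Real.log_le_log (by positivity) h𝒴
  rw [Real.log_rpow two_pos, mul_right_comm, binEnt_mul_log_two] at hX hY
  have hlr := Real.log_pos hr
  have hlt' := mul_lt_mul_of_pos_right hD hlr
  rw [Real.log_div hδ'.ne' hδ0.ne'] at hlog hlt'
  nlinarith


/-- Let `|U| = n ≥ 1`, `δ ∈ (0, 1/2]`, and let `𝒳, 𝒴 ⊆ 2^U` be nonempty families with
`|𝒳|, |𝒴| ≥ 2^{h(δ)·n}`. Then there are `A ∈ 𝒳`, `B ∈ 𝒴` with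
`|A △ B| ≤ n − 2·⌊δn⌋`; in particular `d(𝒳,𝒴) ≤ (1 − 2δ)n + 2`. -/
theorem stmt11 (U : Type) [Fintype U] [DecidableEq U] (n : ℕ) (hn : 1 ≤ n)
    (hU : Fintype.card U = n) (δ : ℝ) (hδ0 : 0 < δ) (hδ1 : δ ≤ 1 / 2)
    (𝒳 𝒴 : Finset (Finset U)) (h𝒳ne : 𝒳.Nonempty) (h𝒴ne : 𝒴.Nonempty)
    (h𝒳 : (𝒳.card : ℝ) ≥ 2 ^ (binEnt δ * n)) (h𝒴 : (𝒴.card : ℝ) ≥ 2 ^ (binEnt δ * n)) :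
    ∃ A ∈ 𝒳, ∃ B ∈ 𝒴,
      (symmDiff A B).card ≤ n - 2 * ⌊δ * n⌋₊ ∧
      ((symmDiff A B).card : ℝ) ≤ (1 - 2 * δ) * n + 2 := by
  subst hU
  obtain ⟨A, hA, B, hB, h⟩ := exists_card_symmDiff_le hδ0 hδ1 h𝒳 h𝒴
  refine ⟨A, hA, B, hB, ?_, by linarith⟩
  have hfloor : (⌊δ * Fintype.card U⌋₊ : ℝ) ≤ δ * Fintype.card U :=
    Nat.floor_le (by positivity)
  refine Nat.le_sub_of_add_le ?_
  have : ((symmDiff A B).card : ℝ) + 2 * ⌊δ * Fintype.card U⌋₊ ≤ Fintype.card U := by linarith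
  exact_mod_cast this
end

section
/- Let U be a finite set with |U| = n ≥ 1, let δ ∈ (0, 1/2], and let 𝒳, 𝒴 ⊆ 2^U be nonempty families with |𝒳| ≥ 2^{h(δ)·n + 1} and |𝒴| ≥ 2^{h(δ)·n + 1}. Then there exists a subfamily 𝒳′ ⊆ 𝒳 with |𝒳′| ≥ |𝒳|/2 such that for every X ∈ 𝒳′ there exists Y ∈ 𝒴 with |X △ Y| ≤ n − 2·⌊δn⌋. -/
/-- The one-coordinate case of `sum_mul_sum_powerset_le`. -/
theorem add_mul_add_le_of_mul_le {t M a b c d : ℝ} (ht : 0 ≤ t) (hM : 0 < M)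
    (hb : 0 ≤ b) (hd : 0 ≤ d)
    (hac : a * c ≤ M * t) (hbd : b * d ≤ M * t) (had : a * d ≤ M) (hbc : b * c ≤ M) :
    (a + b) * (c + d) ≤ (1 + t) ^ 2 * M := by
  have h1 : 0 ≤ (M - a * d) * (M - b * c) :=
    mul_nonneg (sub_nonneg.2 had) (sub_nonneg.2 hbc)
  have h2 : (a * c) * (b * d) ≤ (M * t) * (M * t) :=
    mul_le_mul hac hbd (mul_nonneg hb hd) (mul_nonneg hM.le ht)
  have h3 : M * (a * d + b * c) ≤ M * (M + M * t ^ 2) := by nlinarith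
  have h4 := le_of_mul_le_mul_left h3 hM
  nlinarith

/-- A functional inequality on the cube: if `f X * g Y` is at most `M` times `t` to the number of
coordinates in which `X` and `Y` agree, then the product of the total masses of `f` and `g` is at
most `((1 + t) ^ 2) ^ n * M`. -/
theorem sum_mul_sum_powerset_le {α : Type*} [DecidableEq α] {t : ℝ} (ht : 0 < t) (S : Finset α) :
    ∀ (M : ℝ) (f g : Finset α → ℝ), 0 < M → (∀ X, 0 ≤ f X) → (∀ X, 0 ≤ g X) →
      (∀ X ⊆ S, ∀ Y ⊆ S, f X * g Y ≤ M * t ^ (S \ symmDiff X Y).card) →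
      (∑ X ∈ S.powerset, f X) * (∑ Y ∈ S.powerset, g Y) ≤ ((1 + t) ^ 2) ^ S.card * M := by
  induction S using Finset.induction_on with
  | empty =>
    intro M f g _ _ _ h
    simpa using h ∅ subset_rfl ∅ subset_rfl
  | insert a S ha ih =>
    intro M f g hM hf hg h
    rw [Finset.sum_powerset_insert ha, Finset.sum_powerset_insert ha,
      Finset.card_insert_of_notMem ha, pow_succ', mul_assoc]
    have hC : 0 < ((1 + t) ^ 2) ^ S.card := by positivity
    have agree : ∀ X ⊆ S, ∀ Y ⊆ S,
        (insert a S \ symmDiff X Y).card = (S \ symmDiff X Y).card + 1 ∧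
        (insert a S \ symmDiff (insert a X) (insert a Y)).card = (S \ symmDiff X Y).card + 1 ∧
        insert a S \ symmDiff (insert a X) Y = S \ symmDiff X Y ∧
        insert a S \ symmDiff X (insert a Y) = S \ symmDiff X Y := by
      intro X hX Y hY
      have haX : a ∉ X := fun h => ha (hX h)
      have haY : a ∉ Y := fun h => ha (hY h)
      have hn : a ∉ S \ symmDiff X Y := by simp [ha]
      rw [← Finset.card_insert_of_notMem hn]
      refine ⟨congrArg _ ?_, congrArg _ ?_, ?_, ?_⟩ <;>
        · ext x
          by_cases hx : x = a
          · subst hx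
            simp [Finset.mem_symmDiff, haX, haY, ha]
          · simp [Finset.mem_symmDiff, hx]
    refine add_mul_add_le_of_mul_le ht.le (mul_pos hC hM)
      (Finset.sum_nonneg fun _ _ => hf _) (Finset.sum_nonneg fun _ _ => hg _) ?_ ?_ ?_ ?_
    · rw [mul_assoc]
      refine ih (M * t) f g (by positivity) hf hg fun X hX Y hY => ?_
      have := h X (hX.trans (Finset.subset_insert _ _)) Y (hY.trans (Finset.subset_insert _ _))
      rwa [(agree X hX Y hY).1, pow_succ', ← mul_assoc] at this
    · rw [mul_assoc]
      refine ih (M * t) (fun X => f (insert a X)) (fun Y => g (insert a Y)) (by positivity)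
        (fun _ => hf _) (fun _ => hg _) fun X hX Y hY => ?_
      have := h _ (Finset.insert_subset_insert a hX) _ (Finset.insert_subset_insert a hY)
      rwa [(agree X hX Y hY).2.1, pow_succ', ← mul_assoc] at this
    · refine ih M f (fun Y => g (insert a Y)) hM hf (fun _ => hg _) fun X hX Y hY => ?_
      have := h X (hX.trans (Finset.subset_insert _ _)) _ (Finset.insert_subset_insert a hY)
      rwa [(agree X hX Y hY).2.2.2] at this
    · refine ih M (fun X => f (insert a X)) g hM (fun _ => hf _) hg fun X hX Y hY => ?_
      have := h _ (Finset.insert_subset_insert a hX) Y (hY.trans (Finset.subset_insert _ _))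
      rwa [(agree X hX Y hY).2.2.1] at this

/-- If no member of `A` agrees with a member of `B` in more than `m` coordinates, then `A` and `B`
cannot both be large. -/
theorem card_mul_card_le_of_agreement_le {U : Type*} [Fintype U] [DecidableEq U] {t m : ℝ}
    (ht : 0 < t) (ht1 : t ≤ 1) (A B : Finset (Finset U))
    (h : ∀ X ∈ A, ∀ Y ∈ B, ((Finset.univ \ symmDiff X Y).card : ℝ) ≤ m) :
    (A.card : ℝ) * B.card ≤ ((1 + t) ^ 2) ^ Fintype.card U * t ^ (-m) := by
  have key := sum_mul_sum_powerset_le ht (Finset.univ : Finset U) (t ^ (-m))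
    (fun X => if X ∈ A then 1 else 0) (fun Y => if Y ∈ B then 1 else 0)
    (Real.rpow_pos_of_pos ht _) (fun X => by positivity) (fun Y => by positivity) ?_
  · simpa using key
  · intro X _ Y _
    by_cases hX : X ∈ A
    · by_cases hY : Y ∈ B
      · simp only [hX, hY, if_true, mul_one]
        rw [← Real.rpow_natCast, ← Real.rpow_add ht]
        exact Real.one_le_rpow_of_pos_of_le_one_of_nonpos ht ht1 (by linarith [h X hX Y hY])
      · simp only [hY, if_false, mul_zero]
        positivity
    · simp only [hX, if_false, zero_mul]
      positivity

theorem two_rpow_binEnt {δ : ℝ} (h0 : 0 < δ) (h1 : δ < 1) :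
    (2 : ℝ) ^ binEnt δ = (1 + δ / (1 - δ)) * (δ / (1 - δ)) ^ (-δ) := by
  have h1' : 0 < 1 - δ := sub_pos.2 h1
  have hsum : 1 + δ / (1 - δ) = (1 - δ)⁻¹ := by field_simp; ring
  have hl2 : Real.log 2 ≠ 0 := (Real.log_pos one_lt_two).ne'
  have hpos : 0 < δ / (1 - δ) := div_pos h0 h1'
  rw [hsum]
  refine Real.log_injOn_pos (Set.mem_Ioi.2 (by positivity)) (Set.mem_Ioi.2 (by positivity)) ?_
  rw [Real.log_rpow two_pos, Real.log_mul (by positivity) (by positivity), Real.log_inv,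
    Real.log_rpow hpos, Real.log_div h0.ne' h1'.ne', binEnt, Real.logb, Real.logb]
  field_simp
  ring

/-- Let `|U| = n ≥ 1`, `δ ∈ (0, 1/2]`, and let `𝒳, 𝒴 ⊆ 2^U` be nonempty families with
`|𝒳|, |𝒴| ≥ 2^{h(δ)·n + 1}`. Then there is `𝒳′ ⊆ 𝒳` with `|𝒳′| ≥ |𝒳|/2` such that every
`X ∈ 𝒳′` has some `Y ∈ 𝒴` with `|X △ Y| ≤ n − 2·⌊δn⌋`. -/
theorem stmt12 (U : Type) [Fintype U] [DecidableEq U] (n : ℕ) (hn : 1 ≤ n)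
    (hU : Fintype.card U = n) (δ : ℝ) (hδ0 : 0 < δ) (hδ1 : δ ≤ 1 / 2)
    (𝒳 𝒴 : Finset (Finset U)) (h𝒳ne : 𝒳.Nonempty) (h𝒴ne : 𝒴.Nonempty)
    (h𝒳 : (𝒳.card : ℝ) ≥ 2 ^ (binEnt δ * n + 1))
    (h𝒴 : (𝒴.card : ℝ) ≥ 2 ^ (binEnt δ * n + 1)) :
    ∃ 𝒳' ⊆ 𝒳, ((𝒳'.card : ℝ) ≥ (𝒳.card : ℝ) / 2 ∧
      ∀ X ∈ 𝒳', ∃ Y ∈ 𝒴, (symmDiff X Y).card ≤ n - 2 * ⌊δ * n⌋₊) := by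
  classical
  subst hU
  set n := Fintype.card U
  set k := ⌊δ * n⌋₊
  have hk : (k : ℝ) ≤ δ * n := Nat.floor_le (by positivity)
  refine ⟨{X ∈ 𝒳 | ∃ Y ∈ 𝒴, (symmDiff X Y).card ≤ n - 2 * k}, Finset.filter_subset _ _, ?_,
    fun X hX => (Finset.mem_filter.1 hX).2⟩
  by_contra! hlt
  set P : Finset U → Prop := fun X => ∃ Y ∈ 𝒴, (symmDiff X Y).card ≤ n - 2 * k
  have hsplit : ((𝒳.filter P).card : ℝ) + (𝒳.filter fun X => ¬ P X).card = 𝒳.card := by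
    exact_mod_cast Finset.card_filter_add_card_filter_not P
  have ht : 0 < δ / (1 - δ) := div_pos hδ0 (by linarith)
  have ht1 : δ / (1 - δ) ≤ 1 := (div_le_one (by linarith)).2 (by linarith)
  have hle := card_mul_card_le_of_agreement_le (m := 2 * (δ * n)) ht ht1
    (𝒳.filter fun X => ¬ P X) 𝒴 fun X hX Y hY => by
      have hfar : ¬ (symmDiff X Y).card ≤ n - 2 * k :=
        fun h => (Finset.mem_filter.1 hX).2 ⟨Y, hY, h⟩
      have hcard : (Finset.univ \ symmDiff X Y).card ≤ 2 * k := by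
        rw [← Finset.compl_eq_univ_sdiff, Finset.card_compl]
        omega
      have : ((Finset.univ \ symmDiff X Y).card : ℝ) ≤ 2 * k := by exact_mod_cast hcard
      linarith
  have hE : ((1 + δ / (1 - δ)) ^ 2) ^ n * (δ / (1 - δ)) ^ (-(2 * (δ * n)))
      = (2 : ℝ) ^ (binEnt δ * n) * 2 ^ (binEnt δ * n) := by
    rw [Real.rpow_mul zero_le_two, Real.rpow_natCast, two_rpow_binEnt hδ0 (by linarith), mul_pow,
      ← Real.rpow_mul_natCast ht.le,
      show -(2 * (δ * n)) = -δ * n + -δ * n by ring, Real.rpow_add ht]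
    generalize 1 + δ / (1 - δ) = s
    ring
  have hpow : (2 : ℝ) ^ (binEnt δ * n + 1) = 2 ^ (binEnt δ * n) * 2 := by
    rw [Real.rpow_add two_pos, Real.rpow_one]
  have hq : (0 : ℝ) < 2 ^ (binEnt δ * n) := by positivity
  rw [hpow] at h𝒳 h𝒴
  rw [hE] at hle
  have hbad : (2 : ℝ) ^ (binEnt δ * n) < (𝒳.filter fun X => ¬ P X).card := by linarith
  exact hle.not_gt (mul_lt_mul'' hbad (by linarith) hq.le hq.le)
end

section
/- For every n ≥ 1 and every nonempty set system 𝒜 ⊆ 2^{[n]}, the chain efficiency satisfies η(𝒜) < 1/3.015; equivalently, c(𝒜) · (3.015)^n < |𝒜|² · n!. -/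
/-- Polynomial form of `rpow_three_quarters_quadratic_form_le`, with `a = p ^ 4`, `b = q ^ 4` and
`D = (a + b) ^ (3 / 4)`. -/
theorem quadratic_form_le {p q D : ℝ} (hD : D ^ 4 = (p ^ 4 + q ^ 4) ^ 3) :
    (2 * p ^ 3 + 3 * q ^ 3) ^ 2 + 11 / 2 * (p ^ 3) ^ 2 ≤ 11 * D ^ 2 := by
  set x := p ^ 2 with hx
  set y := q ^ 2 with hy
  have hx0 : 0 ≤ x := sq_nonneg p
  have hy0 : 0 ≤ y := sq_nonneg q
  have hmix : p ^ 3 * q ^ 3 ≤ x * y * (x + y) / 2 := by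
    have : 0 ≤ x * y * (p - q) ^ 2 := by positivity
    rw [hx, hy] at *
    nlinarith
  have hlin : (2 * p ^ 3 + 3 * q ^ 3) ^ 2 + 11 / 2 * (p ^ 3) ^ 2 ≤
      19 / 2 * x ^ 3 + 6 * (x * y * (x + y)) + 9 * y ^ 3 := by
    rw [hx, hy] at *
    nlinarith
  refine hlin.trans (abs_le_of_sq_le_sq' ?_ (by positivity)).2
  have hD' : (11 * D ^ 2) ^ 2 = 121 * (x ^ 2 + y ^ 2) ^ 3 := by
    rw [hx, hy]
    linear_combination 121 * hD
  rw [hD']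
  nlinarith [sq_nonneg (x ^ 3 - y ^ 3), sq_nonneg (x ^ 2 * y - x * y ^ 2),
    sq_nonneg (x * (x ^ 2 - 2 * x * y + y ^ 2)), sq_nonneg (y * (x ^ 2 - 2 * x * y + y ^ 2)),
    sq_nonneg (x * (x ^ 2 - y ^ 2)), sq_nonneg (y * (x ^ 2 - y ^ 2)),
    sq_nonneg (x * (x ^ 2 - x * y)), sq_nonneg (x ^ 2 * y), sq_nonneg (y ^ 3), sq_nonneg (x ^ 3)]

theorem rpow_three_quarters_pow_four {a : ℝ} (ha : 0 ≤ a) : (a ^ (3 / 4 : ℝ)) ^ 4 = a ^ 3 := by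
  rw [← Real.rpow_natCast, ← Real.rpow_mul ha, ← Real.rpow_natCast]
  norm_num

theorem rpow_three_quarters_quadratic_form_le {a b : ℝ} (ha : 0 ≤ a) (hb : 0 ≤ b) :
    (2 * a ^ (3 / 4 : ℝ) + 3 * b ^ (3 / 4 : ℝ)) ^ 2 + 11 / 2 * (a ^ (3 / 4 : ℝ)) ^ 2 ≤
      11 * ((a + b) ^ (3 / 4 : ℝ)) ^ 2 := by
  have key : ∀ {c : ℝ}, 0 ≤ c →
      (c ^ (1 / 4 : ℝ)) ^ 4 = c ∧ (c ^ (1 / 4 : ℝ)) ^ 3 = c ^ (3 / 4 : ℝ) := by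
    intro c hc
    constructor <;> rw [← Real.rpow_natCast, ← Real.rpow_mul hc] <;> norm_num
  have := quadratic_form_le (p := a ^ (1 / 4 : ℝ)) (q := b ^ (1 / 4 : ℝ))
    (D := (a + b) ^ (3 / 4 : ℝ))
    (by rw [(key ha).1, (key hb).1, rpow_three_quarters_pow_four (add_nonneg ha hb)])
  rwa [(key ha).2, (key hb).2] at this

theorem trilinear_form_le {a₀ a₁ b₀ b₁ c₀ c₁ : ℝ} (ha₀ : 0 ≤ a₀) (ha₁ : 0 ≤ a₁)
    (hb₀ : 0 ≤ b₀) (hb₁ : 0 ≤ b₁) (hc₀ : 0 ≤ c₀) (hc₁ : 0 ≤ c₁) :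
    3 * (a₁ ^ (3 / 4 : ℝ) * √b₁ * c₁ ^ (3 / 4 : ℝ)) +
      2 * (a₀ ^ (3 / 4 : ℝ) * √b₁ * c₁ ^ (3 / 4 : ℝ)) +
      2 * (a₀ ^ (3 / 4 : ℝ) * √b₀ * c₁ ^ (3 / 4 : ℝ)) +
      3 * (a₀ ^ (3 / 4 : ℝ) * √b₀ * c₀ ^ (3 / 4 : ℝ)) ≤
    √11 * ((a₁ + a₀) ^ (3 / 4 : ℝ) * √(b₁ + b₀) * (c₁ + c₀) ^ (3 / 4 : ℝ)) := by
  have hA := rpow_three_quarters_quadratic_form_le ha₀ ha₁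
  have hC := rpow_three_quarters_quadratic_form_le hc₁ hc₀
  have hAmono : a₀ ^ (3 / 4 : ℝ) ≤ (a₀ + a₁) ^ (3 / 4 : ℝ) := by gcongr; linarith
  have hCmono : c₁ ^ (3 / 4 : ℝ) ≤ (c₁ + c₀) ^ (3 / 4 : ℝ) := by gcongr; linarith
  rw [add_comm a₁ a₀]
  set u := a₀ ^ (3 / 4 : ℝ)
  set v := a₁ ^ (3 / 4 : ℝ)
  set s := c₁ ^ (3 / 4 : ℝ)
  set t := c₀ ^ (3 / 4 : ℝ)
  set D := (a₀ + a₁) ^ (3 / 4 : ℝ)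
  set D' := (c₁ + c₀) ^ (3 / 4 : ℝ)
  have hu : 0 ≤ u := by positivity
  have hs : 0 ≤ s := by positivity
  have hA2 : u ^ 2 ≤ D ^ 2 := by gcongr
  have hC2 : s ^ 2 ≤ D' ^ 2 := by gcongr
  have hprod : u ^ 2 * (2 * s + 3 * t) ^ 2 + s ^ 2 * (2 * u + 3 * v) ^ 2 ≤ 11 * (D ^ 2 * D' ^ 2) := by
    nlinarith [mul_le_mul_of_nonneg_left hC (sq_nonneg u), mul_le_mul_of_nonneg_left hA (sq_nonneg s),
      mul_nonneg (sub_nonneg.2 hA2) (sub_nonneg.2 hC2)]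
  refine (abs_le_of_sq_le_sq' ?_ (by positivity)).2
  have hb : √(b₁ + b₀) ^ 2 = √b₁ ^ 2 + √b₀ ^ 2 := by
    rw [Real.sq_sqrt hb₀, Real.sq_sqrt hb₁, Real.sq_sqrt (by positivity)]
  calc _ = (√b₀ * (u * (2 * s + 3 * t)) + √b₁ * (s * (2 * u + 3 * v))) ^ 2 := by ring
    _ ≤ (√b₁ ^ 2 + √b₀ ^ 2) *
        (u ^ 2 * (2 * s + 3 * t) ^ 2 + s ^ 2 * (2 * u + 3 * v) ^ 2) := by
      nlinarith [sq_nonneg (√b₀ * (s * (2 * u + 3 * v)) - √b₁ * (u * (2 * s + 3 * t)))]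
    _ ≤ (√b₁ ^ 2 + √b₀ ^ 2) * (11 * (D ^ 2 * D' ^ 2)) := by gcongr
    _ = _ := by
      rw [mul_pow, mul_pow, mul_pow, hb, Real.sq_sqrt (by norm_num : (0 : ℝ) ≤ 11)]
      ring

/-- A colouring `χ : Fin n → Fin 4` encodes the chain `{χ ≤ 0} ⊆ {χ ≤ 1} ⊆ {χ ≤ 2}`; this is the
weight of an element of each colour. -/
def colourWeight : Fin 4 → ℝ := ![3, 2, 2, 3]

theorem sum_pi_succ {α : Type*} [Fintype α] {n : ℕ} (F : (Fin (n + 1) → α) → ℝ) :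
    ∑ x, F x = ∑ a, ∑ y : Fin n → α, F (Fin.cons a y) := by
  rw [← Fintype.sum_prod_type']
  exact ((Fin.consEquiv fun _ => α).sum_comp F).symm

theorem weighted_chain_sum_le (n : ℕ) (F G H : (Fin n → Bool) → ℝ)
    (hF : ∀ x, F x ∈ Set.Icc (0 : ℝ) 1) (hG : ∀ x, G x ∈ Set.Icc (0 : ℝ) 1)
    (hH : ∀ x, H x ∈ Set.Icc (0 : ℝ) 1) :
    ∑ χ : Fin n → Fin 4, (∏ i, colourWeight (χ i)) *
      (F ((decide <| · ≤ 0) ∘ χ) * G ((decide <| · ≤ 1) ∘ χ) * H ((decide <| · ≤ 2) ∘ χ)) ≤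
    √11 ^ n * ((∑ x, F x) ^ (3 / 4 : ℝ) * √(∑ x, G x) * (∑ x, H x) ^ (3 / 4 : ℝ)) := by
  induction n with
  | zero =>
    have key : ∀ z ∈ Set.Icc (0 : ℝ) 1, z ≤ z ^ (3 / 4 : ℝ) := fun z hz =>
      Real.self_le_rpow_of_le_one hz.1 hz.2 (by norm_num)
    have key' : ∀ z ∈ Set.Icc (0 : ℝ) 1, z ≤ √z := fun z hz =>
      Real.le_sqrt_of_sq_le (by nlinarith [hz.1, hz.2])
    have hconst : ∀ K : (Fin 0 → Bool) → ℝ, ∃ k, K = fun _ => k := fun K =>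
      ⟨K Fin.elim0, funext fun x => congrArg K (Subsingleton.elim _ _)⟩
    obtain ⟨f, rfl⟩ := hconst F
    obtain ⟨g, rfl⟩ := hconst G
    obtain ⟨h, rfl⟩ := hconst H
    replace hF := hF Fin.elim0
    replace hG := hG Fin.elim0
    replace hH := hH Fin.elim0
    simp only [Fintype.sum_unique, Finset.univ_eq_empty, Finset.prod_empty, one_mul, pow_zero]
    exact mul_le_mul (mul_le_mul (key f hF) (key' g hG) hG.1 (Real.rpow_nonneg hF.1 _)) (key h hH)
      hH.1 (mul_nonneg (Real.rpow_nonneg hF.1 _) (Real.sqrt_nonneg g))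
  | succ n ih =>
    have hS : ∀ (K : (Fin (n + 1) → Bool) → ℝ), (∀ x, K x ∈ Set.Icc (0 : ℝ) 1) →
        ∀ b, 0 ≤ ∑ y : Fin n → Bool, K (Fin.cons b y) :=
      fun K hK b => Finset.sum_nonneg fun y _ => (hK _).1
    have step := fun a b c => ih (fun y => F (Fin.cons a y)) (fun y => G (Fin.cons b y))
      (fun y => H (Fin.cons c y)) (fun _ => hF _) (fun _ => hG _) (fun _ => hH _)
    have htri := trilinear_form_le (hS F hF false) (hS F hF true) (hS G hG false)
      (hS G hG true) (hS H hH false) (hS H hH true)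
    rw [sum_pi_succ, Fin.sum_univ_four, sum_pi_succ F, sum_pi_succ G, sum_pi_succ H]
    simp only [Fintype.sum_bool, Fin.prod_univ_succ, Fin.cons_zero, Fin.cons_succ, Fin.comp_cons,
      mul_assoc, ← Finset.mul_sum] at step ⊢
    have h0 := step true true true
    have h1 := step false true true
    have h2 := step false false true
    have h3 := step false false false
    have hmul := mul_le_mul_of_nonneg_left htri (by positivity : 0 ≤ √11 ^ n)
    have hw : colourWeight 0 = 3 ∧ colourWeight 1 = 2 ∧ colourWeight 2 = 2 ∧ colourWeight 3 = 3 :=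
      ⟨rfl, rfl, rfl, rfl⟩
    simp only [hw, pow_succ, mul_assoc] at hmul ⊢
    refine le_trans ?_ hmul
    refine (add_le_add (add_le_add (add_le_add (mul_le_mul_of_nonneg_left h0 zero_le_three)
      (mul_le_mul_of_nonneg_left h1 zero_le_two)) (mul_le_mul_of_nonneg_left h2 zero_le_two))
      (mul_le_mul_of_nonneg_left h3 zero_le_three)).trans_eq ?_
    ring

/-- The maximal chains of `𝒜` correspond to orderings of the ground set all of whose
initial segments lie in `𝒜`. -/
theorem chainCount_le_card_perm (n : ℕ) (𝒜 : Finset (Finset (Fin n))) :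
    chainCount n 𝒜 ≤ Nat.card {π : Equiv.Perm (Fin n) //
      ∀ s : Finset (Fin n), IsLowerSet (s : Set (Fin n)) → s.map π.toEmbedding ∈ 𝒜} := by
  have key : ∀ f : {f : Fin (n + 1) → Finset (Fin n) //
      (∀ i, f i ∈ 𝒜) ∧ ∀ i : Fin n, f i.castSucc ⊂ f i.succ},
      ∃ π : Equiv.Perm (Fin n), ∀ k i, π i ∈ f.1 k ↔ i.castSucc < k := by
    rintro ⟨f, -, hf⟩
    have hmono : Monotone f := Fin.monotone_iff_le_succ.2 fun i => (hf i).subset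
    choose g hg hg' using fun i => Finset.exists_of_ssubset (hf i)
    have hmem : ∀ k i, g i ∈ f k ↔ i.castSucc < k := by
      refine fun k i => ⟨fun h => ?_, fun h => hmono (Fin.castSucc_lt_iff_succ_le.1 h) (hg i)⟩
      by_contra hk
      exact hg' i (hmono (not_lt.1 hk) h)
    have hinj : Function.Injective g := by
      intro i j hij
      by_contra hne
      rcases lt_or_gt_of_ne hne with h | h
      · exact hg' j (hij ▸ (hmem _ _).2 (Fin.castSucc_lt_castSucc_iff.2 h))
      · exact hg' i (hij ▸ (hmem _ _).2 (Fin.castSucc_lt_castSucc_iff.2 h))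
    exact ⟨Equiv.ofBijective g (Finite.injective_iff_bijective.1 hinj), hmem⟩
  choose P hP using key
  refine Nat.card_le_card_of_injective (fun f => ⟨P f, fun s hs => ?_⟩) ?_
  · obtain ⟨k, hk⟩ : ∃ k : Fin (n + 1), ∀ i, i ∈ s ↔ i.castSucc < k := by
      rcases hs.eq_univ_or_Iio with h | ⟨a, h⟩
      · exact ⟨Fin.last n, fun i => by simp [← Finset.mem_coe, h, Fin.castSucc_lt_last]⟩
      · exact ⟨a.castSucc, fun i => by simp [← Finset.mem_coe, h]⟩
    have : s.map (P f).toEmbedding = f.1 k := by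
      ext x
      obtain ⟨i, rfl⟩ := (P f).surjective x
      simp [hP, hk]
    rw [this]
    exact f.2.1 k
  · intro f f' h
    have h : P f = P f' := congrArg Subtype.val h
    ext k x
    obtain ⟨i, rfl⟩ := (P f).surjective x
    rw [hP, h, hP]

/-- Double counting: transporting the sorted version of a colouring along the ordering of a maximal
chain yields a colouring whose sublevel sets are all in `𝒜`. -/
theorem chainCount_mul_pow_le {n m : ℕ} (𝒜 : Finset (Finset (Fin n))) (w : Fin m → ℝ)
    (hw : ∀ c, 0 ≤ w c) :
    (chainCount n 𝒜 : ℝ) * (∑ c, w c) ^ n ≤ n.factorial *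
      ∑ χ : Fin n → Fin m with ∀ c, ({i | χ i ≤ c} : Finset (Fin n)) ∈ 𝒜, ∏ i, w (χ i) := by
  classical
  set P : Finset (Equiv.Perm (Fin n)) :=
    {π | ∀ s : Finset (Fin n), IsLowerSet (s : Set (Fin n)) → s.map π.toEmbedding ∈ 𝒜} with hPdef
  set X : Finset (Fin n → Fin m) := {χ | ∀ c, ({i | χ i ≤ c} : Finset (Fin n)) ∈ 𝒜} with hX
  have hcard : (chainCount n 𝒜 : ℝ) ≤ P.card := by
    have := chainCount_le_card_perm n 𝒜
    rw [Nat.card_eq_fintype_card, Fintype.card_subtype] at this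
    exact_mod_cast this
  have hnonneg : ∀ χ : Fin n → Fin m, 0 ≤ ∏ i, w (χ i) :=
    fun χ => Finset.prod_nonneg fun i _ => hw _
  let Φ : Equiv.Perm (Fin n) × (Fin n → Fin m) → Equiv.Perm (Fin n) × (Fin n → Fin m) :=
    fun q => (q.1 * (Tuple.sort q.2)⁻¹, q.2 ∘ (Tuple.sort q.2 * q.1⁻¹ : Equiv.Perm (Fin n)))
  have hΦ : Function.Injective Φ := by
    have hrec : ∀ q, (Φ q).2 ∘ (Φ q).1 = q.2 := by
      intro q
      funext i
      simp [Φ]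
    intro q q' h
    have h2 : q.2 = q'.2 := by rw [← hrec q, ← hrec q', h]
    have h1 : q.1 * (Tuple.sort q.2)⁻¹ = q'.1 * (Tuple.sort q'.2)⁻¹ := congrArg Prod.fst h
    rw [h2] at h1
    exact Prod.ext (mul_right_cancel h1) h2
  calc (chainCount n 𝒜 : ℝ) * (∑ c, w c) ^ n
      ≤ P.card * (∑ c, w c) ^ n := by
        gcongr
        exact pow_nonneg (Finset.sum_nonneg fun c _ => hw c) n
    _ = ∑ q ∈ P ×ˢ (Finset.univ : Finset (Fin n → Fin m)), ∏ i, w (q.2 i) := by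
        simp only [Finset.sum_product, Finset.sum_const, nsmul_eq_mul, Fintype.sum_pow]
    _ = ∑ q ∈ P ×ˢ (Finset.univ : Finset (Fin n → Fin m)), ∏ i, w ((Φ q).2 i) := by
        refine Finset.sum_congr rfl fun q _ => ?_
        exact (Equiv.prod_comp (Tuple.sort q.2 * q.1⁻¹ : Equiv.Perm (Fin n))
          fun i => w (q.2 i)).symm
    _ = ∑ q ∈ (P ×ˢ Finset.univ).image Φ, ∏ i, w (q.2 i) :=
        (Finset.sum_image (f := fun q => ∏ i, w (q.2 i)) hΦ.injOn).symm
    _ ≤ ∑ q ∈ Finset.univ ×ˢ X, ∏ i, w (q.2 i) := by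
        refine Finset.sum_le_sum_of_subset_of_nonneg ?_ fun q _ _ => hnonneg q.2
        intro r hr
        obtain ⟨q, hq, rfl⟩ := Finset.mem_image.1 hr
        have hq1 : q.1 ∈ P := (Finset.mem_product.1 hq).1
        simp only [hPdef, Finset.mem_filter_univ] at hq1
        simp only [Finset.mem_product, Finset.mem_univ, true_and, hX, Finset.mem_filter_univ]
        intro c
        convert hq1 {i | q.2 (Tuple.sort q.2 i) ≤ c} ?_ using 1
        · ext x
          obtain ⟨i, rfl⟩ := q.1.surjective x
          rw [Finset.mem_map_equiv, Equiv.symm_apply_apply, Finset.mem_filter_univ,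
            Finset.mem_filter_univ]
          simp [Φ]
        · intro i j hji hi
          simp only [Finset.coe_filter, Finset.mem_univ, true_and, Set.mem_ofPred_eq] at hi ⊢
          exact (Tuple.monotone_sort q.2 hji).trans hi
    _ = n.factorial * ∑ χ ∈ X, ∏ i, w (χ i) := by
        simp only [Finset.sum_product, Finset.sum_const, nsmul_eq_mul, Finset.card_univ,
          Fintype.card_perm, Fintype.card_fin]

theorem chainCount_mul_ten_pow_le (n : ℕ) (𝒜 : Finset (Finset (Fin n))) :
    (chainCount n 𝒜 : ℝ) * 10 ^ n ≤ n.factorial * (√11 ^ n * (𝒜.card : ℝ) ^ 2) := by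
  classical
  have hsum : ∑ c, colourWeight c = 10 := by
    simp [colourWeight, Fin.sum_univ_four]
    norm_num
  have hw : ∀ c, 0 ≤ colourWeight c := by
    intro c
    fin_cases c <;> simp [colourWeight]
  let F : (Fin n → Bool) → ℝ := fun x => if ({i | x i} : Finset (Fin n)) ∈ 𝒜 then 1 else 0
  have hF : ∀ x, F x ∈ Set.Icc (0 : ℝ) 1 := by
    intro x
    simp only [F]
    split_ifs <;> simp
  have hFsum : ∑ x, F x = 𝒜.card := by
    simp only [F, Finset.sum_boole]
    congr 1
    refine Finset.card_bij' (fun x _ => ({i | x i} : Finset (Fin n)))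
      (fun s _ i => decide (i ∈ s)) ?_ ?_ ?_ ?_ <;> simp
  have h := chainCount_mul_pow_le 𝒜 colourWeight hw
  rw [hsum] at h
  refine h.trans (mul_le_mul_of_nonneg_left ?_ (by positivity))
  have hpow : (𝒜.card : ℝ) ^ (3 / 4 : ℝ) * √𝒜.card * (𝒜.card : ℝ) ^ (3 / 4 : ℝ) = 𝒜.card ^ 2 := by
    rcases (Nat.cast_nonneg (α := ℝ) 𝒜.card).eq_or_lt with h0 | h0
    · simp [← h0]
    · rw [Real.sqrt_eq_rpow, ← Real.rpow_add h0, ← Real.rpow_add h0, ← Real.rpow_natCast]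
      norm_num
  have hbound := weighted_chain_sum_le n F F F hF hF hF
  rw [hFsum, hpow] at hbound
  refine le_trans ?_ hbound
  rw [Finset.sum_filter]
  refine Finset.sum_le_sum fun χ _ => ?_
  have hprod : 0 ≤ ∏ i, colourWeight (χ i) := Finset.prod_nonneg fun i _ => hw _
  split_ifs with hχ
  · have hF1 : ∀ c, F ((decide <| · ≤ c) ∘ χ) = 1 := fun c => by
      simpa [F] using hχ c
    rw [hF1, hF1, hF1, mul_one, mul_one, mul_one]
  · have := fun x => (hF x).1
    exact mul_nonneg hprod (mul_nonneg (mul_nonneg (this _) (this _)) (this _))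

/-- For every `n ≥ 1` and nonempty `𝒜 ⊆ 2^{[n]}`: `η(𝒜) < 1/3.015`; equivalently
`c(𝒜)·3.015^n < |𝒜|²·n!`. -/
theorem stmt13 (n : ℕ) (hn : 1 ≤ n) (𝒜 : Finset (Finset (Fin n))) (hne : 𝒜.Nonempty) :
    eta n 𝒜 < 1 / 3.015 ∧
    (chainCount n 𝒜 : ℝ) * 3.015 ^ n < (𝒜.card : ℝ) ^ 2 * (n.factorial : ℝ) := by
  have hN : 0 < (𝒜.card : ℝ) ^ 2 * (n.factorial : ℝ) := by
    have := hne.card_pos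
    positivity
  have hn0 : n ≠ 0 := Nat.one_le_iff_ne_zero.1 hn
  have main : (chainCount n 𝒜 : ℝ) * 3.015 ^ n < (𝒜.card : ℝ) ^ 2 * (n.factorial : ℝ) := by
    rcases (Nat.cast_nonneg (α := ℝ) (chainCount n 𝒜)).eq_or_lt with h0 | h0
    · rwa [← h0, zero_mul]
    · have hsqrt : 3.015 * √11 < 10 := by
        nlinarith [Real.sq_sqrt (by norm_num : (0 : ℝ) ≤ 11), Real.sqrt_nonneg 11]
      have hlt : (3.015 * √11) ^ n < 10 ^ n := pow_lt_pow_left₀ hsqrt (by positivity) hn0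
      have h11 : 0 < √11 ^ n := by positivity
      refine lt_of_mul_lt_mul_right ?_ h11.le
      calc (chainCount n 𝒜 : ℝ) * 3.015 ^ n * √11 ^ n
          = chainCount n 𝒜 * (3.015 * √11) ^ n := by rw [mul_pow, mul_assoc]
        _ < chainCount n 𝒜 * 10 ^ n := by gcongr
        _ ≤ n.factorial * (√11 ^ n * (𝒜.card : ℝ) ^ 2) := chainCount_mul_ten_pow_le n 𝒜
        _ = _ := by ring
  refine ⟨?_, main⟩
  have hdiv : (chainCount n 𝒜 : ℝ) / ((𝒜.card : ℝ) ^ 2 * (n.factorial : ℝ)) <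
      (1 / 3.015 : ℝ) ^ n := by
    rw [div_lt_iff₀ hN, one_div, inv_pow, ← div_eq_inv_mul, lt_div_iff₀ (by positivity)]
    exact main
  calc eta n 𝒜 < ((1 / 3.015 : ℝ) ^ n) ^ ((1 : ℝ) / n) :=
        Real.rpow_lt_rpow (by positivity) hdiv (by positivity)
    _ = 1 / 3.015 := by
        rw [one_div (n : ℝ)]
        exact Real.pow_rpow_inv_natCast (by norm_num) hn0
end

section
/- Let n be a positive integer divisible by 6, let 𝒜 ⊆ 2^{[n]} be a set system, and let 𝒯 be the set of quadruples (W, X, Y, Z) of pairwise disjoint subsets of [n] with |W| = |Z| = n/3, |X| = |Y| = n/6, and W ∈ 𝒜, W ∪ X ∈ 𝒜, W ∪ X ∪ Y ∈ 𝒜. Then c(𝒜) ≤ |𝒯| · ((n/3)!)² · ((n/6)!)². -/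
theorem Fin.card_filter_le_and_lt (n a c : ℕ) (hc : c ≤ n) :
    (Finset.univ.filter fun i : Fin n => a ≤ (i : ℕ) ∧ (i : ℕ) < c).card = c - a := by
  rw [← Nat.card_Ico, ← Finset.card_map Fin.valEmbedding]
  congr 1
  ext x
  simp only [Finset.mem_map, Finset.mem_filter, Finset.mem_univ, true_and, Fin.valEmbedding_apply,
    Finset.mem_Ico]
  constructor
  · rintro ⟨i, hi, rfl⟩
    exact hi
  · intro hx
    exact ⟨⟨x, by omega⟩, hx, rfl⟩

/-- A maximal chain arises by adding the elements of `[n]` one at a time in some order. -/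
theorem exists_perm_of_chain {n : ℕ} (f : Fin (n + 1) → Finset (Fin n))
    (hf : ∀ i : Fin n, f i.castSucc ⊂ f i.succ) :
    ∃ σ : Equiv.Perm (Fin n), ∀ i j, σ i ∈ f j ↔ (i : ℕ) < (j : ℕ) := by
  have hmono : StrictMono f := Fin.strictMono_iff_lt_succ.2 hf
  choose x hx hx' using fun i => Finset.exists_of_ssubset (hf i)
  have key : ∀ i j, x i ∈ f j ↔ (i : ℕ) < (j : ℕ) := by
    intro i j
    constructor
    · intro h
      by_contra hij
      exact hx' i (hmono.monotone (show j ≤ i.castSucc by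
        simp only [Fin.le_def, Fin.val_castSucc]; omega) h)
    · intro h
      exact hmono.monotone (show i.succ ≤ j by
        simp only [Fin.le_def, Fin.val_succ]; omega) (hx i)
  have hinj : Function.Injective x := by
    intro i i' h
    have h1 := key i i'.succ
    have h2 := key i' i.succ
    rw [h, key] at h1
    rw [← h, key] at h2
    simp only [Fin.val_succ] at h1 h2
    apply Fin.ext
    omega
  exact ⟨Equiv.ofBijective x (Finite.injective_iff_bijective.1 hinj), key⟩

theorem Nat.card_le_card_mul_of_fiber_le {α β : Type*} [Finite α] [Finite β] (g : α → β) (M : ℕ)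
    (h : ∀ a₀, Nat.card {a // g a = g a₀} ≤ M) : Nat.card α ≤ Nat.card β * M := by
  classical
  have := Fintype.ofFinite α
  have := Fintype.ofFinite β
  rw [Nat.card_eq_fintype_card, Nat.card_eq_fintype_card, mul_comm]
  refine (Finset.card_le_mul_card_image (f := g) Finset.univ M fun b hb => ?_).trans
    (Nat.mul_le_mul_left M (Finset.card_le_univ _))
  obtain ⟨a₀, -, rfl⟩ := Finset.mem_image.1 hb
  rw [← Fintype.card_subtype, ← Nat.card_eq_fintype_card]
  exact h a₀

/-- The index of the block of `[6k]` containing `i`, for consecutive blocks of sizes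
`2k, k, k, 2k`. -/
def blockIndex (k : ℕ) (i : Fin (6 * k)) : Fin 4 :=
  if (i : ℕ) < 2 * k then 0 else if (i : ℕ) < 3 * k then 1 else if (i : ℕ) < 4 * k then 2 else 3

theorem card_stabilizer_blockIndex (k : ℕ) :
    Nat.card {g : Equiv.Perm (Fin (6 * k)) // blockIndex k ∘ g = blockIndex k} =
      (2 * k).factorial ^ 2 * k.factorial ^ 2 := by
  rw [Nat.card_eq_fintype_card, DomMulAct.stabilizer_card]
  have h : ∀ (j : Fin 4) (a c : ℕ), c ≤ 6 * k →
      (∀ i, blockIndex k i = j ↔ a ≤ (i : ℕ) ∧ (i : ℕ) < c) →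
      Fintype.card {i // blockIndex k i = j} = c - a := by
    intro j a c hc hj
    rw [Fintype.card_subtype, ← Fin.card_filter_le_and_lt _ a c hc]
    simp only [hj]
  have h0 := h 0 0 (2 * k) (by omega) (fun i => by unfold blockIndex; split_ifs <;> simp <;> omega)
  have h1 := h 1 (2 * k) (3 * k) (by omega)
    (fun i => by unfold blockIndex; split_ifs <;> simp <;> omega)
  have h2 := h 2 (3 * k) (4 * k) (by omega)
    (fun i => by unfold blockIndex; split_ifs <;> simp <;> omega)
  have h3 := h 3 (4 * k) (6 * k) (by omega)
    (fun i => by unfold blockIndex; split_ifs <;> simp <;> omega)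
  rw [Fin.prod_univ_four, h0, h1, h2, h3, show 2 * k - 0 = 2 * k by omega,
    show 3 * k - 2 * k = k by omega, show 4 * k - 3 * k = k by omega,
    show 6 * k - 4 * k = 2 * k by omega]
  ring

/-- For `n` a positive multiple of 6 and `𝒜 ⊆ 2^{[n]}`, letting `𝒯` be the set of quadruples
`(W, X, Y, Z)` of pairwise disjoint subsets of `[n]` with `|W| = |Z| = n/3`,
`|X| = |Y| = n/6` and `W, W ∪ X, W ∪ X ∪ Y ∈ 𝒜`, we have
`c(𝒜) ≤ |𝒯| · ((n/3)!)² · ((n/6)!)²`. -/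
theorem stmt14 (n : ℕ) (hn : 0 < n) (h6 : 6 ∣ n) (𝒜 : Finset (Finset (Fin n))) :
    chainCount n 𝒜 ≤
      Nat.card {q : Finset (Fin n) × Finset (Fin n) × Finset (Fin n) × Finset (Fin n) //
        Disjoint q.1 q.2.1 ∧ Disjoint q.1 q.2.2.1 ∧ Disjoint q.1 q.2.2.2 ∧
        Disjoint q.2.1 q.2.2.1 ∧ Disjoint q.2.1 q.2.2.2 ∧ Disjoint q.2.2.1 q.2.2.2 ∧
        q.1.card = n / 3 ∧ q.2.2.2.card = n / 3 ∧
        q.2.1.card = n / 6 ∧ q.2.2.1.card = n / 6 ∧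
        q.1 ∈ 𝒜 ∧ q.1 ∪ q.2.1 ∈ 𝒜 ∧ q.1 ∪ q.2.1 ∪ q.2.2.1 ∈ 𝒜} *
      (n / 3).factorial ^ 2 * (n / 6).factorial ^ 2 := by
  obtain ⟨k, rfl⟩ := h6
  have e3 : 6 * k / 3 = 2 * k := by omega
  have e6 : 6 * k / 6 = k := by omega
  rw [e3, e6, mul_assoc, ← card_stabilizer_blockIndex, chainCount]
  choose σ hσ using fun f : {f : Fin (6 * k + 1) → Finset (Fin (6 * k)) //
    (∀ i, f i ∈ 𝒜) ∧ ∀ i : Fin (6 * k), f i.castSucc ⊂ f i.succ} =>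
      exists_perm_of_chain f.1 f.2.2
  have hmem : ∀ f (j : Fin (6 * k + 1)) y, y ∈ f.1 j ↔ ((σ f).symm y : ℕ) < (j : ℕ) := by
    intro f j y
    rw [← hσ, Equiv.apply_symm_apply]
  have hσ_inj : Function.Injective σ := by
    intro f f' h
    apply Subtype.ext
    funext j
    ext y
    rw [hmem, hmem, h]
  have hcard : ∀ f (a c : ℕ) (s : Finset (Fin (6 * k))), c ≤ 6 * k →
      (∀ y, y ∈ s ↔ a ≤ ((σ f).symm y : ℕ) ∧ ((σ f).symm y : ℕ) < c) → s.card = c - a := by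
    intro f a c s hc hs
    rw [← Fin.card_filter_le_and_lt _ a c hc, ← Finset.card_map (σ f).symm.toEmbedding]
    congr 1
    ext x
    simp [Finset.mem_map_equiv, hs]
  let p : Fin (6 * k + 1) := ⟨2 * k, by omega⟩
  let q : Fin (6 * k + 1) := ⟨3 * k, by omega⟩
  let r : Fin (6 * k + 1) := ⟨4 * k, by omega⟩
  have hunion : ∀ (f : {f : Fin (6 * k + 1) → Finset (Fin (6 * k)) //
    (∀ i, f i ∈ 𝒜) ∧ ∀ i : Fin (6 * k), f i.castSucc ⊂ f i.succ}) (i j : Fin (6 * k + 1)),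
      (i : ℕ) ≤ j → f.1 i ∪ f.1 j \ f.1 i = f.1 j := by
    intro f i j hij
    ext y
    simp only [Finset.mem_union, Finset.mem_sdiff, hmem]
    omega
  have hpq : (p : ℕ) ≤ q := by simp only [p, q]; omega
  have hqr : (q : ℕ) ≤ r := by simp only [q, r]; omega
  refine Nat.card_le_card_mul_of_fiber_le (fun f : {f : Fin (6 * k + 1) → Finset (Fin (6 * k)) //
    (∀ i, f i ∈ 𝒜) ∧ ∀ i : Fin (6 * k), f i.castSucc ⊂ f i.succ} =>
    ⟨(f.1 p, f.1 q \ f.1 p, f.1 r \ f.1 q, (f.1 r)ᶜ), ?_⟩) _ fun f₀ => ?_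
  swap
  · refine ⟨?_, ?_, ?_, ?_, ?_, ?_, ?_, ?_, ?_, ?_, f.2.1 p, ?_, ?_⟩
    iterate 6
      rw [Finset.disjoint_left]
      intro y
      simp only [Finset.mem_compl, Finset.mem_sdiff, hmem, p, q, r]
      omega
    · refine (hcard f 0 (2 * k) _ (by omega) fun y => ?_).trans (by omega)
      simp only [hmem, p]
      omega
    · refine (hcard f (4 * k) (6 * k) _ (by omega) fun y => ?_).trans (by omega)
      simp only [Finset.mem_compl, hmem, r]
      omega
    · refine (hcard f (2 * k) (3 * k) _ (by omega) fun y => ?_).trans (by omega)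
      simp only [Finset.mem_sdiff, hmem, p, q]
      omega
    · refine (hcard f (3 * k) (4 * k) _ (by omega) fun y => ?_).trans (by omega)
      simp only [Finset.mem_sdiff, hmem, q, r]
      omega
    · simpa only [hunion f p q hpq] using f.2.1 q
    · simpa only [hunion f p q hpq, hunion f q r hqr] using f.2.1 r
  · refine Nat.card_le_card_of_injective
      (fun f => ⟨(σ f.1).trans (σ f₀).symm, ?_⟩) fun f f' h => ?_
    · obtain ⟨f, hf⟩ := f
      have h := congrArg Subtype.val hf
      simp only [Prod.mk.injEq] at h
      have hp : f.1 p = f₀.1 p := h.1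
      have hq : f.1 q = f₀.1 q := by rw [← hunion f p q hpq, ← hunion f₀ p q hpq, h.2.1, hp]
      have hr : f.1 r = f₀.1 r := by rw [← hunion f q r hqr, ← hunion f₀ q r hqr, h.2.2.1, hq]
      have hlt : ∀ j, f.1 j = f₀.1 j →
          ∀ i, ((σ f₀).symm (σ f i) : ℕ) < (j : ℕ) ↔ (i : ℕ) < (j : ℕ) := by
        intro j hj i
        rw [← hmem, ← hj, hσ]
      funext i
      have h1 := hlt p hp i
      have h2 := hlt q hq i
      have h3 := hlt r hr i
      simp only [p, q, r] at h1 h2 h3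
      simp only [Function.comp_apply, Equiv.trans_apply, blockIndex, h1, h2, h3]
    · apply Subtype.ext
      apply hσ_inj
      ext i
      have hi := congrArg (fun g => g i) (congrArg Subtype.val h)
      exact congrArg Fin.val ((σ f₀).symm.injective hi)
end

section
/- For every positive integer d and all real constants q ∈ (0,1) and ε ∈ (0, 1/2), there exists m₀ such that for every integer m > m₀ we have Σ_{i=0}^{m} binomial(m, i) · 2^{ m · binomial(m−d, i) / binomial(m, i) } ≥ 2^{ m · (h(q) + q^d) · (1 − ε) }. -/
/-- The mean of the binomial distribution with parameters `m` and `p`. -/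
lemma sum_mul_binomial_weight (m : ℕ) (p : ℝ) :
    ∑ i ∈ Finset.range (m + 1), (i : ℝ) * ((m.choose i : ℝ) * p ^ i * (1 - p) ^ (m - i)) =
      m * p := by
  have h := congrArg (Polynomial.eval p) (bernsteinPolynomial.sum_smul ℝ m)
  simpa [bernsteinPolynomial, Polynomial.eval_finsetSum] using h

/-- The binomial weights with parameters `m` and `p` sum to `1`. -/
lemma sum_binomial_weight (m : ℕ) (p : ℝ) :
    ∑ i ∈ Finset.range (m + 1), (m.choose i : ℝ) * p ^ i * (1 - p) ^ (m - i) = 1 := by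
  have h := congrArg (Polynomial.eval p) (bernsteinPolynomial.sum ℝ m)
  simpa [bernsteinPolynomial, Polynomial.eval_finsetSum] using h

/-- The mean of `(m - d).choose i / m.choose i` under the binomial distribution. -/
lemma sum_choose_sub_binomial_weight {m d : ℕ} (hdm : d ≤ m) (p : ℝ) :
    ∑ i ∈ Finset.range (m + 1), ((m - d).choose i : ℝ) * p ^ i * (1 - p) ^ (m - i) =
      (1 - p) ^ d := by
  have hsub : Finset.range (m - d + 1) ⊆ Finset.range (m + 1) := by
    intro i; simp only [Finset.mem_range]; omega
  rw [← Finset.sum_subset hsub]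
  · calc
      _ = (1 - p) ^ d * ∑ i ∈ Finset.range (m - d + 1),
            ((m - d).choose i : ℝ) * p ^ i * (1 - p) ^ (m - d - i) := ?_
      _ = (1 - p) ^ d := by rw [sum_binomial_weight, mul_one]
    rw [Finset.mul_sum]
    refine Finset.sum_congr rfl fun i hi ↦ ?_
    have hi' : m - i = d + (m - d - i) := by simp only [Finset.mem_range] at hi; omega
    rw [hi', pow_add]
    ring
  · intro i _ hi
    rw [Nat.choose_eq_zero_of_lt (by simp only [Finset.mem_range] at hi; omega)]
    simp

/-- The inequality holds without the factor `1 - ε` as soon as `d ≤ m`, by Jensen's inequality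
for the binomial distribution with parameters `m` and `1 - q`. -/
lemma two_rpow_binEnt_add_pow_le_sum {m d : ℕ} (hdm : d ≤ m) {q : ℝ} (hq0 : 0 < q)
    (hq1 : q < 1) :
    (2 : ℝ) ^ ((m : ℝ) * (binEnt q + q ^ d)) ≤
      ∑ i ∈ Finset.range (m + 1),
        (m.choose i : ℝ) *
          (2 : ℝ) ^ (((m * (m - d).choose i : ℕ) : ℝ) / ((m.choose i : ℕ) : ℝ)) := by
  obtain ⟨p, rfl⟩ : ∃ p, q = 1 - p := ⟨1 - q, by ring⟩
  have hp0 : 0 < p := by linarith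
  set w : ℕ → ℝ := fun i ↦ (m.choose i : ℝ) * p ^ i * (1 - p) ^ (m - i) with hw
  set x : ℕ → ℝ := fun i ↦
    Real.log 2 * (((m * (m - d).choose i : ℕ) : ℝ) / ((m.choose i : ℕ) : ℝ)) -
      i * Real.log p - (m - i) * Real.log (1 - p) with hx
  have hlog : Real.log 2 ≠ 0 := (Real.log_pos one_lt_two).ne'
  have jensen := convexOn_exp.map_sum_le (t := Finset.range (m + 1)) (w := w) (p := x)
    (fun i _ ↦ by positivity) (sum_binomial_weight m p) (fun _ _ ↦ Set.mem_univ _)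
  have hmean : ∑ i ∈ Finset.range (m + 1), w i • x i =
      Real.log 2 * ((m : ℝ) * (binEnt (1 - p) + (1 - p) ^ d)) := by
    have hterm : ∀ i ∈ Finset.range (m + 1), w i • x i =
        Real.log 2 * m * (((m - d).choose i : ℝ) * p ^ i * (1 - p) ^ (m - i)) +
          (Real.log (1 - p) - Real.log p) * (i * w i) - m * Real.log (1 - p) * w i := by
      intro i hi
      have hc : (m.choose i : ℝ) ≠ 0 := by
        have := Nat.choose_pos (Nat.lt_succ_iff.mp (Finset.mem_range.mp hi))
        positivity
      simp only [hw, hx, smul_eq_mul]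
      push_cast
      field_simp
      ring
    rw [Finset.sum_congr rfl hterm, Finset.sum_sub_distrib, Finset.sum_add_distrib,
      ← Finset.mul_sum, ← Finset.mul_sum, ← Finset.mul_sum, sum_choose_sub_binomial_weight hdm,
      sum_mul_binomial_weight, sum_binomial_weight, binEnt, sub_sub_cancel, Real.logb, Real.logb]
    field_simp
    ring
  rw [hmean, ← Real.rpow_def_of_pos two_pos] at jensen
  refine jensen.trans_eq (Finset.sum_congr rfl fun i hi ↦ ?_)
  have him : i ≤ m := Nat.lt_succ_iff.mp (Finset.mem_range.mp hi)
  have hexp : Real.exp (x i) =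
      (2 : ℝ) ^ (((m * (m - d).choose i : ℕ) : ℝ) / ((m.choose i : ℕ) : ℝ)) / p ^ i /
        (1 - p) ^ (m - i) := by
    simp only [hx]
    rw [Real.exp_sub, Real.exp_sub, ← Real.rpow_def_of_pos two_pos, Real.exp_nat_mul,
      Real.exp_log hp0, ← Nat.cast_sub him, Real.exp_nat_mul, Real.exp_log hq0]
  rw [hexp, hw, smul_eq_mul]
  field_simp

/-- For every positive integer `d` and constants `q ∈ (0,1)`, `ε ∈ (0, 1/2)`, there exists
`m₀` such that for all `m > m₀`:
`Σ_{i=0}^{m} binomial(m, i)·2^{m·binomial(m−d, i)/binomial(m, i)} ≥ 2^{m·(h(q)+q^d)·(1−ε)}`. -/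
theorem stmt18 (d : ℕ) (hd : 1 ≤ d) (q ε : ℝ) (hq0 : 0 < q) (hq1 : q < 1)
    (hε0 : 0 < ε) (hε1 : ε < 1 / 2) :
    ∃ m₀ : ℕ, ∀ m : ℕ, m > m₀ →
      ∑ i ∈ Finset.range (m + 1),
        (m.choose i : ℝ) *
          (2 : ℝ) ^ (((m * (m - d).choose i : ℕ) : ℝ) / ((m.choose i : ℕ) : ℝ))
      ≥ (2 : ℝ) ^ ((m : ℝ) * (binEnt q + q ^ d) * (1 - ε)) := by
  refine ⟨d, fun m hm ↦ le_trans ?_ (two_rpow_binEnt_add_pow_le_sum hm.le hq0 hq1)⟩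
  have hent : 0 ≤ binEnt q := by
    have h₁ := Real.logb_nonpos one_lt_two hq0.le hq1.le
    have h₂ := Real.logb_nonpos one_lt_two (sub_nonneg.mpr hq1.le) (by linarith : 1 - q ≤ 1)
    unfold binEnt
    nlinarith
  exact Real.rpow_le_rpow_of_exponent_le one_le_two
    (mul_le_of_le_one_right (by positivity) (by linarith))
end
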